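/- arXiv:math/0509410 — 2 statements merged into one kernel-verified Lean document; each statement's English description precedes it below -/
import Mathlib

section
/- If a partial coloring of an n×n square uniquely extends to L(n, 2n-2), then the number of uncolored entries is at most 8n/5; equivalently, d(L(n, 2n-2)) ≥ n² - ⌊8n/5⌋. -/
/-- An `L(n,k)`: an `n × n` array colored with `k` colors such that all entries
in any row and any column have distinct colors. -/
def IsLatin (n k : ℕ) (L : Fin n → Fin n → Fin k) : Prop :=
  (∀ i : Fin n, Function.Injective (L i)) ∧
  (∀ j : Fin n, Function.Injective (fun i => L i j))

/-- `L` extends the partial coloring `P`. -/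
def ExtendsPC {n k : ℕ} (P : Fin n → Fin n → Option (Fin k))
    (L : Fin n → Fin n → Fin k) : Prop :=
  ∀ i j c, P i j = some c → L i j = c

/-- The partial coloring `P` uniquely extends to an `L(n,k)`. -/
def UniquelyExtends (n k : ℕ) (P : Fin n → Fin n → Option (Fin k)) : Prop :=
  ∃! L : Fin n → Fin n → Fin k, IsLatin n k L ∧ ExtendsPC P L

/-- Number of uncolored entries of a partial coloring. -/
def numUncolored {n k : ℕ} (P : Fin n → Fin n → Option (Fin k)) : ℕ :=
  (Finset.univ.filter (fun p : Fin n × Fin n => P p.1 p.2 = none)).card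

/-- Number of colored entries of a partial coloring. -/
def numColored {n k : ℕ} (P : Fin n → Fin n → Option (Fin k)) : ℕ :=
  (Finset.univ.filter (fun p : Fin n × Fin n => P p.1 p.2 ≠ none)).card

/-- The defining number `d(L(n,k))`. -/
noncomputable def definingNumber (n k : ℕ) : ℕ :=
  sInf {m | ∃ P : Fin n → Fin n → Option (Fin k),
    UniquelyExtends n k P ∧ numColored P = m}

/-- The set of available colors for entry `(i,j)`: colors not appearing among
the colored entries of row `i` or column `j`. -/
def availColors {n k : ℕ} (P : Fin n → Fin n → Option (Fin k)) (i j : Fin n) :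
    Finset (Fin k) :=
  Finset.univ.filter (fun c => (∀ w, P i w ≠ some c) ∧ (∀ h, P h j ≠ some c))

namespace LatinAux

open Finset

/-- Nonbacktracking counting lemma. -/
theorem count_aux {V : Type*} [Fintype V] [DecidableEq V] (adj : V → V → Prop)
    [DecidableRel adj] (hs : ∀ u v, adj u v → adj v u)
    (hdeg : ∀ v a b c, adj v a → adj v b → adj v c → a = b ∨ b = c ∨ a = c)
    (hw : ∀ v0 v1 v2 v3 v4 v5, adj v0 v1 → adj v1 v2 → adj v2 v3 → adj v3 v4 → adj v4 v5 →
      v0 ≠ v2 → v1 ≠ v3 → v2 ≠ v4 → v3 ≠ v5 → False) :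
    5 * (univ.filter (fun p : V × V => adj p.1 p.2)).card ≤ 8 * Fintype.card V := by
  classical
  set D := univ.filter (fun p : V × V => adj p.1 p.2) with hD
  let leaf : Finset V := univ.filter (fun v => ∃ u, adj u v ∧ ∀ w, adj w v → w = u)
  let nx : Finset (V × V) → Finset (V × V) := fun S =>
    univ.filter (fun p : V × V => adj p.1 p.2 ∧ ∃ w, w ≠ p.1 ∧ (p.2, w) ∈ S)
  let T0 : Finset (V × V) := univ.filter (fun p : V × V => adj p.1 p.2 ∧ ∀ w, adj w p.2 → w = p.1)
  have hT0 : T0.card ≤ leaf.card := by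
    apply Finset.card_le_card_of_injOn (fun p => p.2)
    · intro p hp
      simp only [T0, leaf, coe_filter, mem_univ, true_and, Set.mem_ofPred_eq] at hp ⊢
      exact ⟨p.1, hp⟩
    · intro p hp q hq h
      simp only [T0, coe_filter, mem_univ, true_and, Set.mem_ofPred_eq] at hp hq h
      refine Prod.ext ?_ h
      exact hq.2 _ (h ▸ hp.1)
  have hnx : ∀ S ⊆ D, (nx S).card ≤ S.card := by
    intro S hS
    apply Finset.card_le_card_of_forall_subsingleton
      (fun p q : V × V => adj p.1 p.2 ∧ q.1 = p.2 ∧ q.2 ≠ p.1)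
    · intro p hp
      simp only [nx, mem_filter, mem_univ, true_and] at hp
      obtain ⟨h1, w, h2, h3⟩ := hp
      exact ⟨(p.2, w), h3, h1, rfl, h2⟩
    · rintro ⟨v, w⟩ hq ⟨a, b⟩ ⟨_, ha, hb, hc⟩ ⟨a', b'⟩ ⟨_, ha', hb', hc'⟩
      have hvw := hS hq
      simp only [hD, mem_filter, mem_univ, true_and] at hvw
      simp only at ha hb hc ha' hb' hc'
      subst hb; subst hb'
      have := hdeg v a a' w (hs _ _ ha) (hs _ _ ha') hvw
      simp only [Prod.mk.injEq, and_true]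
      grind
  have hnxD : ∀ S, nx S ⊆ D := by
    intro S p hp
    simp only [nx, hD, mem_filter, mem_univ, true_and] at hp ⊢
    exact hp.1
  have hT0D : T0 ⊆ D := by
    intro p hp
    simp only [T0, hD, mem_filter, mem_univ, true_and] at hp ⊢
    exact hp.1
  have hstep : ∀ u v, adj u v → (u, v) ∉ T0 → ∃ w, w ≠ u ∧ adj v w := by
    intro u v h1 h2
    simp only [T0, mem_filter, mem_univ, true_and, not_and, not_forall] at h2
    obtain ⟨w, h3, h4⟩ := h2 h1
    exact ⟨w, h4, hs _ _ h3⟩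
  have hmem : ∀ S u v w, adj u v → w ≠ u → (v, w) ∈ S → (u, v) ∈ nx S := by
    intro S u v w h1 h2 h3
    simp only [nx, mem_filter, mem_univ, true_and]
    exact ⟨h1, w, h2, h3⟩
  have hcover : D ⊆ T0 ∪ nx T0 ∪ nx (nx T0) ∪ nx (nx (nx T0)) := by
    rintro ⟨v0, v1⟩ hp
    simp only [hD, mem_filter, mem_univ, true_and] at hp
    simp only [mem_union]
    by_contra hcon
    push Not at hcon
    obtain ⟨⟨⟨c0, c1⟩, c2⟩, c3⟩ := hcon
    obtain ⟨v2, n2, a2⟩ := hstep _ _ hp c0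
    have d1 : (v1, v2) ∉ T0 := fun h => c1 (hmem _ _ _ _ hp n2 h)
    obtain ⟨v3, n3, a3⟩ := hstep _ _ a2 d1
    have d2 : (v2, v3) ∉ T0 := fun h => c2 (hmem _ _ _ _ hp n2 (hmem _ _ _ _ a2 n3 h))
    obtain ⟨v4, n4, a4⟩ := hstep _ _ a3 d2
    have d3 : (v3, v4) ∉ T0 := fun h =>
      c3 (hmem _ _ _ _ hp n2 (hmem _ _ _ _ a2 n3 (hmem _ _ _ _ a3 n4 h)))
    obtain ⟨v5, n5, a5⟩ := hstep _ _ a4 d3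
    exact hw v0 v1 v2 v3 v4 v5 hp a2 a3 a4 a5 n2.symm n3.symm n4.symm n5.symm
  have e1 := hnx T0 hT0D
  have e2 := hnx _ (hnxD T0)
  have e3 := hnx _ (hnxD (nx T0))
  have e4 := card_le_card hcover
  have f1 := card_union_le (T0 ∪ nx T0 ∪ nx (nx T0)) (nx (nx (nx T0)))
  have f2 := card_union_le (T0 ∪ nx T0) (nx (nx T0))
  have f3 := card_union_le T0 (nx T0)
  have g : D.card + leaf.card ≤ 2 * Fintype.card V := by
    have h1 : D.card = ∑ v : V, (univ.filter (fun u => adj u v)).card := by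
      rw [Finset.card_eq_sum_card_fiberwise (f := Prod.snd) (t := univ) (by simp)]
      apply Finset.sum_congr rfl
      intro v _
      apply Finset.card_bij (fun p _ => p.1)
      · rintro ⟨a, b⟩ h
        simp only [hD, mem_filter, mem_univ, true_and] at h ⊢
        exact h.2 ▸ h.1
      · rintro ⟨a, b⟩ h ⟨a', b'⟩ h' e
        simp only [hD, mem_filter, mem_univ, true_and] at h h' e
        exact Prod.ext e (h.2.trans h'.2.symm)
      · intro u hu
        simp only [mem_filter, mem_univ, true_and] at hu
        exact ⟨(u, v), by simp [hD, hu], rfl⟩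
    have h2 : leaf.card = ∑ v : V, if v ∈ leaf then 1 else 0 := by simp
    rw [h1, h2, ← Finset.sum_add_distrib]
    have : ∑ v : V, 2 = 2 * Fintype.card V := by simp [mul_comm]
    rw [← this]
    apply Finset.sum_le_sum
    intro v _
    split_ifs with hv
    · simp only [leaf, mem_filter, mem_univ, true_and] at hv
      obtain ⟨u, _, hu⟩ := hv
      have : (univ.filter (fun u => adj u v)).card ≤ 1 := by
        rw [Finset.card_le_one]
        intro a ha b hb
        simp only [mem_filter, mem_univ, true_and] at ha hb
        rw [hu a ha, hu b hb]
      omega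
    · by_contra hc
      have : 2 < (univ.filter (fun u => adj u v)).card := by omega
      rw [Finset.two_lt_card] at this
      obtain ⟨a, ha, b, hb, c, hc, h1, h2, h3⟩ := this
      simp only [mem_filter, mem_univ, true_and] at ha hb hc
      have := hdeg v a b c (hs _ _ ha) (hs _ _ hb) (hs _ _ hc)
      tauto
  omega

/-- `L` is the only Latin array agreeing with `L` outside `U`. -/
def Uniq {n k : ℕ} (L : Fin n → Fin n → Fin k) (U : Finset (Fin n × Fin n)) : Prop :=
  IsLatin n k L ∧ ∀ L', IsLatin n k L' → (∀ i j, (i, j) ∉ U → L' i j = L i j) → L' = L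

theorem Uniq.key {n k : ℕ} {L : Fin n → Fin n → Fin k} {U : Finset (Fin n × Fin n)}
    (h : Uniq L U) (L' : Fin n → Fin n → Fin k) (W : Finset (Fin n × Fin n)) (hW : W ⊆ U)
    (h0 : ∀ i j, (i, j) ∉ W → L' i j = L i j)
    (h1 : ∀ i j j', (i, j) ∈ W → j ≠ j' → L' i j ≠ L' i j')
    (h2 : ∀ i i' j, (i, j) ∈ W → i ≠ i' → L' i j ≠ L' i' j) : L' = L := by
  refine h.2 L' ⟨?_, ?_⟩ (fun i j hij => h0 i j (fun hh => hij (hW hh)))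
  · intro i j j' e
    by_contra hne
    by_cases a : (i, j) ∈ W
    · exact h1 _ _ _ a hne e
    by_cases b : (i, j') ∈ W
    · exact h1 _ _ _ b (Ne.symm hne) e.symm
    rw [h0 _ _ a, h0 _ _ b] at e
    exact hne (h.1.1 i e)
  · intro j i i' e
    simp only at e
    by_contra hne
    by_cases a : (i, j) ∈ W
    · exact h2 _ _ _ a hne e
    by_cases b : (i', j) ∈ W
    · exact h2 _ _ _ b (Ne.symm hne) e.symm
    rw [h0 _ _ a, h0 _ _ b] at e
    exact hne (h.1.2 j e)

theorem Uniq.transpose {n k : ℕ} {L : Fin n → Fin n → Fin k} {U : Finset (Fin n × Fin n)}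
    (h : Uniq L U) : Uniq (fun i j => L j i) (U.image Prod.swap) := by
  refine ⟨⟨h.1.2, h.1.1⟩, ?_⟩
  intro L' hL' hag
  have := h.2 (fun i j => L' j i) ⟨hL'.2, hL'.1⟩ (fun i j hij => hag j i (by
    simpa using hij))
  funext i j
  exact congrFun (congrFun this j) i

theorem exists_alt {n : ℕ} {L : Fin n → Fin n → Fin (2*n-2)}
    (i j : Fin n) (R C : Finset (Fin n)) (h : 4 ≤ R.card + C.card) :
    ∃ d, d ≠ L i j ∧ (∀ j', j' ∉ R → d ≠ L i j') ∧ (∀ i', i' ∉ C → d ≠ L i' j) := by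
  have hR := Finset.card_le_univ R
  have hC := Finset.card_le_univ C
  simp only [Fintype.card_fin] at hR hC
  let S : Finset (Fin (2*n-2)) := {L i j} ∪ (Rᶜ.image (fun j' => L i j')) ∪ (Cᶜ.image (fun i' => L i' j))
  have a1 : (Rᶜ.image (fun j' => L i j')).card ≤ n - R.card := by
    refine card_image_le.trans ?_
    simp [card_compl]
  have a2 : (Cᶜ.image (fun i' => L i' j)).card ≤ n - C.card := by
    refine card_image_le.trans ?_
    simp [card_compl]
  have a3 := card_union_le ({L i j} ∪ (Rᶜ.image (fun j' => L i j'))) (Cᶜ.image (fun i' => L i' j))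
  have a4 := card_union_le {L i j} (Rᶜ.image (fun j' => L i j'))
  rw [card_singleton] at a4
  have : S.card < Fintype.card (Fin (2*n-2)) := by
    rw [Fintype.card_fin]; simp only [S]; omega
  obtain ⟨d, hd⟩ : ∃ d, d ∉ S := by
    by_contra hcon
    push Not at hcon
    rw [(Finset.eq_univ_iff_forall).2 hcon] at this
    simp at this
  simp only [S, mem_union, mem_singleton, mem_image, mem_compl, not_or, not_exists, not_and] at hd
  exact ⟨d, hd.1.1, fun j' h e => hd.1.2 j' h e.symm, fun j' h e => hd.2 j' h e.symm⟩

theorem claw {n : ℕ} {L : Fin n → Fin n → Fin (2*n-2)} {U : Finset (Fin n × Fin n)}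
    (h : Uniq L U) (i j1 j2 j3 : Fin n) (h1 : (i, j1) ∈ U) (h2 : (i, j2) ∈ U) (h3 : (i, j3) ∈ U)
    (h12 : j1 ≠ j2) (h23 : j2 ≠ j3) (h13 : j1 ≠ j3) : False := by
  have hc : ({j1, j2, j3} : Finset (Fin n)).card = 3 := Finset.card_eq_three.2 ⟨_, _, _, h12, h13, h23, rfl⟩
  have hq : 4 ≤ ({j1, j2, j3} : Finset (Fin n)).card + ({i} : Finset (Fin n)).card := by
    rw [hc, card_singleton]
  obtain ⟨d1, n1, r1, c1⟩ := exists_alt (L := L) i j1 _ _ hq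
  obtain ⟨d2, n2, r2, c2⟩ := exists_alt (L := L) i j2 _ _ hq
  obtain ⟨d3, n3, r3, c3⟩ := exists_alt (L := L) i j3 _ _ hq
  simp only [mem_insert, mem_singleton, not_or] at r1 r2 r3 c1 c2 c3
  have hL1 := h.1.1
  have hL2 := h.1.2
  have hLr : ∀ i j j', j ≠ j' → L i j ≠ L i j' := fun i j j' hh e => hh (hL1 i e)
  have hLc : ∀ i i' j, i ≠ i' → L i j ≠ L i' j := fun i i' j hh e => hh (hL2 j e)
  have main : ∀ x1 x2 x3, (x1 = L i j1 ∨ x1 = d1) → (x2 = L i j2 ∨ x2 = d2) →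
      (x3 = L i j3 ∨ x3 = d3) → x1 ≠ x2 → x2 ≠ x3 → x1 ≠ x3 →
      x1 = L i j1 ∧ x2 = L i j2 ∧ x3 = L i j3 := by
    intro x1 x2 x3 hx1 hx2 hx3 y12 y23 y13
    have p1 : ∀ j', ¬ (j' = j1) → ¬ (j' = j2) → ¬ (j' = j3) → x1 ≠ L i j' := by grind
    have p2 : ∀ j', ¬ (j' = j1) → ¬ (j' = j2) → ¬ (j' = j3) → x2 ≠ L i j' := by grind
    have p3 : ∀ j', ¬ (j' = j1) → ¬ (j' = j2) → ¬ (j' = j3) → x3 ≠ L i j' := by grind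
    have q1 : ∀ i', ¬ (i' = i) → x1 ≠ L i' j1 := by grind
    have q2 : ∀ i', ¬ (i' = i) → x2 ≠ L i' j2 := by grind
    have q3 : ∀ i', ¬ (i' = i) → x3 ≠ L i' j3 := by grind
    have := h.key (fun a b => if a = i ∧ b = j1 then x1 else if a = i ∧ b = j2 then x2 else
      if a = i ∧ b = j3 then x3 else L a b) {(i, j1), (i, j2), (i, j3)}
      (by intro p hp; simp only [mem_insert, mem_singleton] at hp; grind)
      (by intro a b hab; simp only [mem_insert, mem_singleton, Prod.mk.injEq, not_or] at hab; grind)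
      (by intro a b b' hab; simp only [mem_insert, mem_singleton, Prod.mk.injEq] at hab; grind)
      (by intro a b b' hab; simp only [mem_insert, mem_singleton, Prod.mk.injEq] at hab; grind)
    have e1 := congrFun (congrFun this i) j1
    have e2 := congrFun (congrFun this i) j2
    have e3 := congrFun (congrFun this i) j3
    grind
  clear r1 r2 r3 c1 c2 c3
  have m12 := hLr i _ _ h12
  have m23 := hLr i _ _ h23
  have m13 := hLr i _ _ h13
  generalize L i j1 = a1 at *
  generalize L i j2 = a2 at *
  generalize L i j3 = a3 at *
  have k1 := main d1 a2 a3 (.inr rfl) (.inl rfl) (.inl rfl)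
  have k2 := main a1 d2 a3 (.inl rfl) (.inr rfl) (.inl rfl)
  have k3 := main a1 a2 d3 (.inl rfl) (.inl rfl) (.inr rfl)
  have k4 := main d1 d2 a3 (.inr rfl) (.inr rfl) (.inl rfl)
  have k5 := main a1 d2 d3 (.inl rfl) (.inr rfl) (.inr rfl)
  have k6 := main d1 a2 d3 (.inr rfl) (.inl rfl) (.inr rfl)
  have k7 := main d1 d2 d3 (.inr rfl) (.inr rfl) (.inr rfl)
  clear main hL1 hL2 hLr hLc h
  grind

theorem cycle4 {n : ℕ} {L : Fin n → Fin n → Fin (2*n-2)} {U : Finset (Fin n × Fin n)}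
    (h : Uniq L U) (i i' j j' : Fin n) (h1 : (i, j) ∈ U) (h2 : (i', j) ∈ U) (h3 : (i', j') ∈ U)
    (h4 : (i, j') ∈ U) (hi : i ≠ i') (hj : j ≠ j') : False := by
  have hq : 4 ≤ ({j, j'} : Finset (Fin n)).card + ({i, i'} : Finset (Fin n)).card := by
    rw [card_pair hi, card_pair hj]
  obtain ⟨d1, n1, r1, c1⟩ := exists_alt (L := L) i j _ _ hq
  obtain ⟨d2, n2, r2, c2⟩ := exists_alt (L := L) i' j _ _ hq
  obtain ⟨d3, n3, r3, c3⟩ := exists_alt (L := L) i' j' _ _ hq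
  obtain ⟨d4, n4, r4, c4⟩ := exists_alt (L := L) i j' _ _ hq
  simp only [mem_insert, mem_singleton, not_or] at r1 r2 r3 r4 c1 c2 c3 c4
  have hL1 := h.1.1
  have hL2 := h.1.2
  have hLr : ∀ i j j', j ≠ j' → L i j ≠ L i j' := fun i j j' hh e => hh (hL1 i e)
  have hLc : ∀ i i' j, i ≠ i' → L i j ≠ L i' j := fun i i' j hh e => hh (hL2 j e)
  have main : ∀ x1 x2 x3 x4, (x1 = L i j ∨ x1 = d1) → (x2 = L i' j ∨ x2 = d2) →
      (x3 = L i' j' ∨ x3 = d3) → (x4 = L i j' ∨ x4 = d4) →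
      x1 ≠ x2 → x2 ≠ x3 → x3 ≠ x4 → x4 ≠ x1 →
      x1 = L i j ∧ x2 = L i' j ∧ x3 = L i' j' ∧ x4 = L i j' := by
    intro x1 x2 x3 x4 hx1 hx2 hx3 hx4 y12 y23 y34 y41
    have p1 : ∀ b, ¬ (b = j) → ¬ (b = j') → x1 ≠ L i b := by grind
    have p2 : ∀ b, ¬ (b = j) → ¬ (b = j') → x2 ≠ L i' b := by grind
    have p3 : ∀ b, ¬ (b = j) → ¬ (b = j') → x3 ≠ L i' b := by grind
    have p4 : ∀ b, ¬ (b = j) → ¬ (b = j') → x4 ≠ L i b := by grind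
    have q1 : ∀ b, ¬ (b = i) → ¬ (b = i') → x1 ≠ L b j := by grind
    have q2 : ∀ b, ¬ (b = i) → ¬ (b = i') → x2 ≠ L b j := by grind
    have q3 : ∀ b, ¬ (b = i) → ¬ (b = i') → x3 ≠ L b j' := by grind
    have q4 : ∀ b, ¬ (b = i) → ¬ (b = i') → x4 ≠ L b j' := by grind
    clear r1 r2 r3 r4 c1 c2 c3 c4
    have := h.key (fun a b => if a = i ∧ b = j then x1 else if a = i' ∧ b = j then x2 else
      if a = i' ∧ b = j' then x3 else if a = i ∧ b = j' then x4 else L a b)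
      {(i, j), (i', j), (i', j'), (i, j')}
      (by intro p hp; simp only [mem_insert, mem_singleton] at hp; grind)
      (by intro a b hab; simp only [mem_insert, mem_singleton, Prod.mk.injEq, not_or] at hab; grind)
      (by intro a b b' hab; simp only [mem_insert, mem_singleton, Prod.mk.injEq] at hab; grind)
      (by intro a b b' hab; simp only [mem_insert, mem_singleton, Prod.mk.injEq] at hab; grind)
    have e1 := congrFun (congrFun this i) j
    have e2 := congrFun (congrFun this i') j
    have e3 := congrFun (congrFun this i') j'
    have e4 := congrFun (congrFun this i) j'
    grind
  clear r1 r2 r3 r4 c1 c2 c3 c4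
  have m12 := hLc _ _ j hi
  have m23 := hLr i' _ _ hj
  have m34 := hLc _ _ j' hi
  have m41 := hLr i _ _ hj
  clear hL1 hL2 hLr hLc h
  generalize L i j = a1 at *
  generalize L i' j = a2 at *
  generalize L i' j' = a3 at *
  generalize L i j' = a4 at *
  have k1 := main d1 a2 a3 a4 (.inr rfl) (.inl rfl) (.inl rfl) (.inl rfl)
  have k2 := main a1 d2 a3 a4 (.inl rfl) (.inr rfl) (.inl rfl) (.inl rfl)
  have k3 := main a1 a2 d3 a4 (.inl rfl) (.inl rfl) (.inr rfl) (.inl rfl)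
  have k4 := main a1 a2 a3 d4 (.inl rfl) (.inl rfl) (.inl rfl) (.inr rfl)
  have k12 := main d1 d2 a3 a4 (.inr rfl) (.inr rfl) (.inl rfl) (.inl rfl)
  have k23 := main a1 d2 d3 a4 (.inl rfl) (.inr rfl) (.inr rfl) (.inl rfl)
  have k34 := main a1 a2 d3 d4 (.inl rfl) (.inl rfl) (.inr rfl) (.inr rfl)
  have k41 := main d1 a2 a3 d4 (.inr rfl) (.inl rfl) (.inl rfl) (.inr rfl)
  have k13 := main d1 a2 d3 a4 (.inr rfl) (.inl rfl) (.inr rfl) (.inl rfl)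
  have k24 := main a1 d2 a3 d4 (.inl rfl) (.inr rfl) (.inl rfl) (.inr rfl)
  have k123 := main d1 d2 d3 a4 (.inr rfl) (.inr rfl) (.inr rfl) (.inl rfl)
  have k234 := main a1 d2 d3 d4 (.inl rfl) (.inr rfl) (.inr rfl) (.inr rfl)
  have k341 := main d1 a2 d3 d4 (.inr rfl) (.inl rfl) (.inr rfl) (.inr rfl)
  have k412 := main d1 d2 a3 d4 (.inr rfl) (.inr rfl) (.inl rfl) (.inr rfl)
  have k1234 := main d1 d2 d3 d4 (.inr rfl) (.inr rfl) (.inr rfl) (.inr rfl)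
  clear main h1 h2 h3 h4 hi hj hq
  grind

theorem left_ext {α : Type*} [DecidableEq α] (A B : Finset α) (a b x : α) (ha : a ∈ A) (hb : b ∈ B)
    (hab : a ≠ b) (hB : 2 ≤ B.card) (h : ¬ (x = b ∧ A ⊆ {a} ∧ B ⊆ {a, b})) :
    ∃ y1 ∈ A, ∃ y2 ∈ B, y1 ≠ y2 ∧ y2 ≠ x := by
  by_cases hx : x = b
  · by_cases hA : A ⊆ {a}
    · have hBB : ¬ B ⊆ {a, b} := fun h' => h ⟨hx, hA, h'⟩
      rw [Finset.not_subset] at hBB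
      obtain ⟨y, hy, hy'⟩ := hBB
      simp only [mem_insert, mem_singleton, not_or] at hy'
      exact ⟨a, ha, y, hy, Ne.symm hy'.1, hx ▸ hy'.2⟩
    · rw [Finset.not_subset] at hA
      obtain ⟨y, hy, hy'⟩ := hA
      simp only [mem_singleton] at hy'
      obtain ⟨z, hz, hzb⟩ := Finset.exists_mem_ne (show 1 < B.card by omega) b
      by_cases hza : z = a
      · exact ⟨y, hy, z, hz, by rw [hza]; exact hy', hx ▸ hzb⟩
      · exact ⟨a, ha, z, hz, Ne.symm hza, hx ▸ hzb⟩
  · exact ⟨a, ha, b, hb, hab, Ne.symm hx⟩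

/-- The pure set-theoretic contradiction, one-sided core. -/
theorem path_core {α : Type*} [DecidableEq α]
    (S0 T0 S1 T1 L1 L2 L3 : Finset α) (a1 a2 f : α)
    (d0 : Disjoint S0 T0)
    (m1 : ∀ x, x ∈ L1 ↔ x ∉ S0 ∧ x ∉ T0)
    (m2 : ∀ x, x ∈ L2 ↔ x ∉ T0 ∧ x ∉ S1)
    (m3 : ∀ x, x ∈ L3 ↔ x ∉ S1 ∧ x ∉ T1)
    (h1 : a1 ∈ L1) (hL2 : L2 ⊆ {a1, a2}) (h3 : a2 ∈ L3) (hf : f ∈ S0) :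
    f ∈ S1 ∨ f = a2 := by
  have hT : f ∉ T0 := Finset.disjoint_left.1 d0 hf
  by_cases hS : f ∈ S1
  · exact .inl hS
  · have := hL2 ((m2 f).2 ⟨hT, hS⟩)
    simp only [mem_insert, mem_singleton] at this
    rcases this with h | h
    · exact absurd hf (h ▸ ((m1 _).1 h1).1)
    · exact .inr h

theorem path_half {α : Type*} [DecidableEq α]
    (S0 T0 S1 T1 S2 T2 L1 L2 L3 L4 L5 : Finset α) (a1 a2 a3 a4 a5 f g h : α)
    (c1 : L1.card = 1 + (S0 ∩ T0).card)
    (c3 : L3.card = 2 + (S1 ∩ T1).card)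
    (c5 : L5.card = 1 + (T2 ∩ S2).card)
    (m1 : ∀ x, x ∈ L1 ↔ x ∉ S0 ∧ x ∉ T0)
    (m2 : ∀ x, x ∈ L2 ↔ x ∉ T0 ∧ x ∉ S1)
    (m3 : ∀ x, x ∈ L3 ↔ x ∉ S1 ∧ x ∉ T1)
    (m4 : ∀ x, x ∈ L4 ↔ x ∉ S2 ∧ x ∉ T1)
    (m5 : ∀ x, x ∈ L5 ↔ x ∉ T2 ∧ x ∉ S2)
    (h1 : a1 ∈ L1) (h5 : a5 ∈ L5)
    (hl : L1 ⊆ {a1} ∧ L2 ⊆ {a1, a2}) (ha2 : a2 ∈ L3)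
    (hun : ∀ x ∈ L3, x ≠ a3 → (x = a2 ∨ (x = a4 ∧ L5 ⊆ {a5} ∧ L4 ⊆ {a5, a4})))
    (hf0 : f ∈ S0) (hf1 : f ∈ T1) (hg0 : g ∈ S0) (hg1 : g ∈ T2) (hh0 : h ∈ S1) (hh1 : h ∈ T2)
    (hfg : f ≠ g) : False := by
  have d0 : Disjoint S0 T0 := by
    have := card_le_card hl.1
    rw [card_singleton] at this
    rw [disjoint_iff_inter_eq_empty, ← card_eq_zero]; omega
  have core := fun x hx => path_core S0 T0 S1 T1 L1 L2 L3 a1 a2 x d0 m1 m2 m3 h1 hl.2 ha2 hx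
  have hf : f ∈ S1 := by
    rcases core f hf0 with h | h
    · exact h
    · exact absurd hf1 (h ▸ ((m3 _).1 ha2).2)
  have hpos : 1 ≤ (S1 ∩ T1).card := Finset.card_pos.2 ⟨f, mem_inter.2 ⟨hf, hf1⟩⟩
  have h4 : ∃ y ∈ L3, y ∉ ({a2, a3} : Finset α) := by
    by_contra hcon
    push Not at hcon
    have := card_le_card (show L3 ⊆ {a2, a3} from hcon)
    have := card_le_two (a := a2) (b := a3)
    omega
  obtain ⟨y, hy, hyn⟩ := h4
  simp only [mem_insert, mem_singleton, not_or] at hyn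
  rcases hun y hy hyn.2 with h' | ⟨rfl, hr⟩
  · exact hyn.1 h'
  have hL3 : L3 ⊆ {a2, a3, y} := by
    intro x hx
    simp only [mem_insert, mem_singleton]
    by_cases hx3 : x = a3
    · exact .inr (.inl hx3)
    · rcases hun x hx hx3 with h' | h'
      · exact .inl h'
      · exact .inr (.inr h'.1)
  have h3le := (card_le_card hL3).trans (card_le_three)
  have d5 : Disjoint T2 S2 := by
    have := card_le_card hr.1
    rw [card_singleton] at this
    rw [disjoint_iff_inter_eq_empty, ← card_eq_zero]; omega
  have core' := fun x hx => path_core T2 S2 T1 S1 L5 L4 L3 a5 y x d5 m5 m4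
    (fun x => (m3 x).trans and_comm) h5 hr.2 hy hx
  have hone : (S1 ∩ T1).card ≤ 1 := by omega
  rw [Finset.card_le_one] at hone
  have y1 := (m3 y).1 hy
  have z1 := (m3 a2).1 ha2
  rcases core g hg0 with p | p
  · rcases core' g hg1 with q | q
    · exact hfg (hone f (mem_inter.2 ⟨hf, hf1⟩) g (mem_inter.2 ⟨p, q⟩))
    · exact y1.1 (q ▸ p)
  · rcases core' g hg1 with q | q
    · exact z1.2 (p ▸ q)
    · exact hyn.1 (q.symm.trans p)

theorem path_sets {α : Type*} [DecidableEq α]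
    (S0 T0 S1 T1 S2 T2 L1 L2 L3 L4 L5 : Finset α) (a1 a2 a3 a4 a5 f g h : α)
    (c1 : L1.card = 1 + (S0 ∩ T0).card)
    (c2 : 2 ≤ L2.card)
    (c3 : L3.card = 2 + (S1 ∩ T1).card)
    (c4 : 2 ≤ L4.card)
    (c5 : L5.card = 1 + (T2 ∩ S2).card)
    (m1 : ∀ x, x ∈ L1 ↔ x ∉ S0 ∧ x ∉ T0)
    (m2 : ∀ x, x ∈ L2 ↔ x ∉ T0 ∧ x ∉ S1)
    (m3 : ∀ x, x ∈ L3 ↔ x ∉ S1 ∧ x ∉ T1)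
    (m4 : ∀ x, x ∈ L4 ↔ x ∉ S2 ∧ x ∉ T1)
    (m5 : ∀ x, x ∈ L5 ↔ x ∉ T2 ∧ x ∉ S2)
    (h1 : a1 ∈ L1) (h2 : a2 ∈ L2) (h4 : a4 ∈ L4) (h5 : a5 ∈ L5)
    (n12 : a1 ≠ a2) (n45 : a4 ≠ a5)
    (hun : ∀ x1 ∈ L1, ∀ x2 ∈ L2, ∀ x3 ∈ L3, ∀ x4 ∈ L4, ∀ x5 ∈ L5,
      x1 ≠ x2 → x2 ≠ x3 → x3 ≠ x4 → x4 ≠ x5 → x3 = a3)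
    (hf0 : f ∈ S0) (hf1 : f ∈ T1) (hg0 : g ∈ S0) (hg1 : g ∈ T2) (hh0 : h ∈ S1) (hh1 : h ∈ T2)
    (hfg : f ≠ g) (hgh : h ≠ g) : False := by
  have key : ∀ x ∈ L3, x ≠ a3 → (x = a2 ∧ L1 ⊆ {a1} ∧ L2 ⊆ {a1, a2}) ∨
      (x = a4 ∧ L5 ⊆ {a5} ∧ L4 ⊆ {a5, a4}) := by
    intro x hx hx3
    by_contra hcon
    rw [not_or] at hcon
    obtain ⟨y1, hy1, y2, hy2, e1, e2⟩ := left_ext L1 L2 a1 a2 x h1 h2 n12 c2 hcon.1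
    obtain ⟨y5, hy5, y4, hy4, e3, e4⟩ := left_ext L5 L4 a5 a4 x h5 h4 n45.symm c4 hcon.2
    exact hx3 (hun y1 hy1 y2 hy2 x hx y4 hy4 y5 hy5 e1 e2 e4.symm e3.symm)
  obtain ⟨x, hx, hx3⟩ := Finset.exists_mem_ne (show 1 < L3.card by omega) a3
  rcases key x hx hx3 with ⟨rfl, hl⟩ | ⟨rfl, hr⟩
  · exact path_half S0 T0 S1 T1 S2 T2 L1 L2 L3 L4 L5 a1 x a3 a4 a5 f g h c1 c3 c5 m1 m2 m3 m4 m5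
      h1 h5 hl hx (fun z hz hz3 => (key z hz hz3).imp (fun t => t.1) id) hf0 hf1 hg0 hg1 hh0 hh1 hfg
  · exact path_half T2 S2 T1 S1 T0 S0 L5 L4 L3 L2 L1 a5 x a3 a2 a1 h g f c5
      (by rw [inter_comm]; exact c3) c1 m5 m4
      (fun x => (m3 x).trans and_comm) m2 m1
      h5 h1 hr hx (fun z hz hz3 => (key z hz hz3).symm.imp (fun t => t.1) id)
      hh1 hh0 hg1 hg0 hf1 hf0 hgh

theorem compl_card {k : ℕ} (S T : Finset (Fin k)) (s t r : ℕ) (hs : S.card = s) (ht : T.card = t)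
    (h : k + 0 = s + t + r) : ((S ∪ T)ᶜ).card = r + (S ∩ T).card := by
  have := card_union_add_card_inter S T
  have h2 := card_le_univ (S ∪ T)
  rw [Fintype.card_fin] at h2
  rw [card_compl, Fintype.card_fin]
  omega

theorem path6 {n : ℕ} {L : Fin n → Fin n → Fin (2*n-2)} {U : Finset (Fin n × Fin n)}
    (h : Uniq L U) (r0 r1 r2 c0 c1 c2 : Fin n)
    (h1 : (r0, c0) ∈ U) (h2 : (r1, c0) ∈ U) (h3 : (r1, c1) ∈ U)
    (h4 : (r2, c1) ∈ U) (h5 : (r2, c2) ∈ U)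
    (r01 : r0 ≠ r1) (r12 : r1 ≠ r2) (r02 : r0 ≠ r2)
    (c01 : c0 ≠ c1) (c12 : c1 ≠ c2) (c02 : c0 ≠ c2) : False := by
  have hn : 3 ≤ n := by
    have hc : ({r0, r1, r2} : Finset (Fin n)).card = 3 :=
      Finset.card_eq_three.2 ⟨_, _, _, r01, r02, r12, rfl⟩
    have := card_le_univ ({r0, r1, r2} : Finset (Fin n))
    rw [hc, Fintype.card_fin] at this
    exact this
  have hLr : ∀ i j j', j ≠ j' → L i j ≠ L i j' := fun i j j' hh e => hh (h.1.1 i e)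
  have hLc : ∀ i i' j, i ≠ i' → L i j ≠ L i' j := fun i i' j hh e => hh (h.1.2 j e)
  have rowc : ∀ i (R : Finset (Fin n)), (Rᶜ.image (L i)).card = n - R.card := by
    intro i R
    rw [card_image_of_injective _ (h.1.1 i), card_compl, Fintype.card_fin]
  have colc : ∀ j (R : Finset (Fin n)), (Rᶜ.image (fun i => L i j)).card = n - R.card := by
    intro i R
    rw [card_image_of_injective _ (h.1.2 i), card_compl, Fintype.card_fin]
  have rowm : ∀ i (R : Finset (Fin n)) x, x ∈ (Rᶜ.image (L i)) ↔ ∃ j, j ∉ R ∧ L i j = x := by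
    intro i R x; simp
  have colm : ∀ j (R : Finset (Fin n)) x, x ∈ (Rᶜ.image (fun i => L i j)) ↔
      ∃ i, i ∉ R ∧ L i j = x := by
    intro i R x; simp
  have q1 := rowc r0 {c0}
  have q2 := colc c0 {r0, r1}
  have q3 := rowc r1 {c0, c1}
  have q4 := colc c1 {r1, r2}
  have q5 := rowc r2 {c1, c2}
  have q6 := colc c2 {r2}
  rw [card_singleton] at q1 q6
  rw [card_pair r01] at q2
  rw [card_pair c01] at q3
  rw [card_pair r12] at q4
  rw [card_pair c12] at q5
  have w1 := rowm r0 {c0}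
  have w2 := colm c0 {r0, r1}
  have w3 := rowm r1 {c0, c1}
  have w4 := colm c1 {r1, r2}
  have w5 := rowm r2 {c1, c2}
  have w6 := colm c2 {r2}
  generalize (({c0} : Finset (Fin n))ᶜ.image (L r0)) = S0 at q1 w1
  generalize (({r0, r1} : Finset (Fin n))ᶜ.image (fun i => L i c0)) = T0 at q2 w2
  generalize (({c0, c1} : Finset (Fin n))ᶜ.image (L r1)) = S1 at q3 w3
  generalize (({r1, r2} : Finset (Fin n))ᶜ.image (fun i => L i c1)) = T1 at q4 w4
  generalize (({c1, c2} : Finset (Fin n))ᶜ.image (L r2)) = S2 at q5 w5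
  generalize (({r2} : Finset (Fin n))ᶜ.image (fun i => L i c2)) = T2 at q6 w6
  clear rowc colc rowm colm
  simp only [mem_insert, mem_singleton, not_or] at w1 w2 w3 w4 w5 w6
  have k1 := compl_card S0 T0 _ _ 1 q1 q2 (by omega)
  have k2 := compl_card T0 S1 _ _ 2 q2 q3 (by omega)
  have k3 := compl_card S1 T1 _ _ 2 q3 q4 (by omega)
  have k4 := compl_card S2 T1 _ _ 2 q5 q4 (by omega)
  have k5 := compl_card T2 S2 _ _ 1 q6 q5 (by omega)
  refine path_sets S0 T0 S1 T1 S2 T2 (S0 ∪ T0)ᶜ (T0 ∪ S1)ᶜ (S1 ∪ T1)ᶜ (S2 ∪ T1)ᶜ (T2 ∪ S2)ᶜ (L r0 c0) (L r1 c0) (L r1 c1) (L r2 c1) (L r2 c2)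
    (L r0 c1) (L r0 c2) (L r1 c2) k1 (by omega) k3 (by omega) k5
    (by simp) (by simp) (by simp) (by simp) (by simp)
    ?_ ?_ ?_ ?_ (hLc _ _ _ r01) (hLr _ _ _ c12) ?_
    ((w1 _).2 ⟨c1, c01.symm, rfl⟩) ((w4 _).2 ⟨r0, ⟨r01, r02⟩, rfl⟩)
    ((w1 _).2 ⟨c2, c02.symm, rfl⟩) ((w6 _).2 ⟨r0, r02, rfl⟩)
    ((w3 _).2 ⟨c2, ⟨c02.symm, c12.symm⟩, rfl⟩) ((w6 _).2 ⟨r1, r12, rfl⟩)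
    (hLr _ _ _ c12) (hLc _ _ _ r01.symm)
  · simp only [mem_compl, mem_union, not_or, w1, w2]; grind
  · simp only [mem_compl, mem_union, not_or, w3, w2]; grind
  · simp only [mem_compl, mem_union, not_or, w4, w5]; grind
  · simp only [mem_compl, mem_union, not_or, w5, w6]; grind
  · simp only [mem_compl, mem_union, not_or, w1, w2, w3, w4, w5, w6, not_exists, not_and]
    clear q1 q2 q3 q4 q5 q6 w1 w2 w3 w4 w5 w6 k1 k2 k3 k4 k5
    rintro x1 ⟨l1, l1'⟩ x2 ⟨l2, l2'⟩ x3 ⟨l3, l3'⟩ x4 ⟨l4, l4'⟩ x5 ⟨l5, l5'⟩ e12 e23 e34 e45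
    have := h.key (fun a b => if a = r0 ∧ b = c0 then x1 else if a = r1 ∧ b = c0 then x2 else
      if a = r1 ∧ b = c1 then x3 else if a = r2 ∧ b = c1 then x4 else
      if a = r2 ∧ b = c2 then x5 else L a b)
      {(r0, c0), (r1, c0), (r1, c1), (r2, c1), (r2, c2)}
      (by intro p hp; simp only [mem_insert, mem_singleton] at hp; grind)
      (by intro a b hab; simp only [mem_insert, mem_singleton, Prod.mk.injEq, not_or] at hab; grind)
      (by
        intro a b b' hab
        simp only [mem_insert, mem_singleton, Prod.mk.injEq] at hab
        rcases hab with ⟨rfl, rfl⟩ | ⟨rfl, rfl⟩ | ⟨rfl, rfl⟩ | ⟨rfl, rfl⟩ | ⟨rfl, rfl⟩ <;> grind)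
      (by
        intro a b b' hab
        simp only [mem_insert, mem_singleton, Prod.mk.injEq] at hab
        rcases hab with ⟨rfl, rfl⟩ | ⟨rfl, rfl⟩ | ⟨rfl, rfl⟩ | ⟨rfl, rfl⟩ | ⟨rfl, rfl⟩ <;> grind)
    have e3 := congrFun (congrFun this r1) c1
    grind

/-- Adjacency of the bipartite graph of uncolored cells. -/
def badj {n : ℕ} (U : Finset (Fin n × Fin n)) : Fin n ⊕ Fin n → Fin n ⊕ Fin n → Prop
  | .inl i, .inr j => (i, j) ∈ U
  | .inr j, .inl i => (i, j) ∈ U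
  | _, _ => False

theorem main_bound {n : ℕ} {L : Fin n → Fin n → Fin (2*n-2)} {U : Finset (Fin n × Fin n)}
    (h : Uniq L U) : 5 * U.card ≤ 8 * n := by
  classical
  have hp : ∀ r0 r1 r2 c0 c1 c2, (r0, c0) ∈ U → (r1, c0) ∈ U → (r1, c1) ∈ U →
      (r2, c1) ∈ U → (r2, c2) ∈ U → r0 ≠ r1 → r1 ≠ r2 → c0 ≠ c1 → c1 ≠ c2 → False := by
    intro r0 r1 r2 c0 c1 c2 h1 h2 h3 h4 h5 n1 n2 n3 n4
    by_cases e : r0 = r2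
    · subst e
      exact cycle4 h _ _ _ _ h1 h2 h3 h4 n1 n3
    by_cases e' : c0 = c2
    · subst e'
      exact cycle4 h _ _ _ _ h2 h5 h4 h3 n2 n3
    exact path6 h r0 r1 r2 c0 c1 c2 h1 h2 h3 h4 h5 n1 n2 e n3 n4 e'
  have hcount := count_aux (badj U)
    (by rintro (u | u) (v | v) <;> simp [badj])
    (by
      rintro (v | v) (a | a) (b | b) (c | c) h1 h2 h3 <;> simp only [badj] at h1 h2 h3
      · by_contra hcon
        simp only [Sum.inr.injEq, not_or] at hcon
        exact claw h v a b c h1 h2 h3 hcon.1 hcon.2.1 hcon.2.2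
      · by_contra hcon
        simp only [Sum.inl.injEq, not_or] at hcon
        exact claw h.transpose v a b c (by simpa using h1) (by simpa using h2)
          (by simpa using h3) hcon.1 hcon.2.1 hcon.2.2)
    (by
      rintro (v0 | v0) (v1 | v1) a b c d h1 h2 h3 h4 h5 n1 n2 n3 n4
      · exact h1
      · rcases a with a | a <;> rcases b with b | b <;> rcases c with c | c <;>
          rcases d with d | d <;> simp only [badj] at h2 h3 h4 h5
        exact hp v0 a c v1 b d h1 h2 h3 h4 h5 (by simpa using n1) (by simpa using n3)
          (by simpa using n2) (by simpa using n4)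
      · rcases a with a | a <;> rcases b with b | b <;> rcases c with c | c <;>
          rcases d with d | d <;> simp only [badj] at h2 h3 h4 h5
        exact hp d b v1 c a v0 h5 h4 h3 h2 h1 (by simpa using n4.symm) (by simpa using n2.symm)
          (by simpa using n3.symm) (by simpa using n1.symm)
      · exact h1)
  have hle : (U.disjSum U).card ≤
      (univ.filter (fun p : (Fin n ⊕ Fin n) × (Fin n ⊕ Fin n) => badj U p.1 p.2)).card := by
    apply Finset.card_le_card_of_injOn (fun p => match p with
      | .inl q => (Sum.inl q.1, Sum.inr q.2)
      | .inr q => (Sum.inr q.2, Sum.inl q.1))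
    · rintro (⟨a, b⟩ | ⟨a, b⟩) hq <;>
        simp only [mem_coe, inl_mem_disjSum, inr_mem_disjSum] at hq <;>
        rw [mem_coe, mem_filter] <;> exact ⟨mem_univ _, hq⟩
    · rintro (⟨a, b⟩ | ⟨a, b⟩) hq (⟨a', b'⟩ | ⟨a', b'⟩) hq' <;> simp <;> tauto
  rw [card_disjSum] at hle
  rw [Fintype.card_sum, Fintype.card_fin] at hcount
  omega

theorem exists_latin (n : ℕ) (hn : 2 ≤ n) : ∃ L, IsLatin n (2*n-2) L := by
  have hpos : 0 < n := by omega
  refine ⟨fun i j => ⟨(i.1 + j.1) % n, (Nat.mod_lt _ hpos).trans_le (by omega)⟩, ?_, ?_⟩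
  · intro i j j' e
    simp only [Fin.mk.injEq] at e
    have : j.1 ≡ j'.1 [MOD n] := Nat.ModEq.add_left_cancel' i.1 e
    exact Fin.ext (Nat.ModEq.eq_of_lt_of_lt this j.2 j'.2)
  · intro i j j' e
    simp only [Fin.mk.injEq] at e
    have : j.1 ≡ j'.1 [MOD n] := Nat.ModEq.add_right_cancel' i.1 e
    exact Fin.ext (Nat.ModEq.eq_of_lt_of_lt this j.2 j'.2)

theorem part1 (n : ℕ) (P : Fin n → Fin n → Option (Fin (2*n-2)))
    (hP : UniquelyExtends n (2*n-2) P) : 5 * numUncolored P ≤ 8 * n := by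
  obtain ⟨L, ⟨hL, hE⟩, hU⟩ := hP
  apply main_bound (L := L)
  refine ⟨hL, fun L' hL' hag => hU L' ⟨hL', ?_⟩⟩
  intro i j c hc
  rw [hag i j (by simp [hc])]
  exact hE i j c hc

end LatinAux

theorem uncolored_at_most_8n_over_5 (n : ℕ) :
    (∀ P : Fin n → Fin n → Option (Fin (2*n-2)),
      UniquelyExtends n (2*n-2) P → 5 * numUncolored P ≤ 8 * n) ∧
    n^2 - (8*n)/5 ≤ definingNumber n (2*n-2) := by
  refine ⟨LatinAux.part1 n, ?_⟩
  rcases Nat.lt_or_ge n 2 with hn | hn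
  · have : n^2 - (8*n)/5 = 0 := by interval_cases n <;> rfl
    omega
  · unfold definingNumber
    apply le_csInf
    · obtain ⟨L, hL⟩ := LatinAux.exists_latin n hn
      refine ⟨_, fun i j => some (L i j), ⟨L, ⟨hL, ?_⟩, ?_⟩, rfl⟩
      · intro i j c hc
        exact Option.some.inj hc
      · rintro L' ⟨_, h'⟩
        funext i j
        exact h' i j _ rfl
    · rintro m ⟨P, hP, rfl⟩
      have h1 := LatinAux.part1 n P hP
      have h2 : numUncolored P + numColored P = n^2 := by
        unfold numUncolored numColored
        rw [Finset.card_filter_add_card_filter_not]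
        simp [sq]
      omega
end

section
/- For every n divisible by 10, d(L(n, 2n-2)) = n² - 8n/5. -/
def Rig {n k : ℕ} (E : Fin n → Fin n → Prop) (L : Fin n → Fin n → Fin k) : Prop :=
  IsLatin n k L ∧ ∀ L', IsLatin n k L' → (∀ i j, ¬ E i j → L' i j = L i j) → L' = L

def Crit {n k : ℕ} (L : Fin n → Fin n → Fin k) (x y : Fin n) (f : Fin k) : Prop :=
  f ≠ L x y ∧ (∀ t, (∃ j, L x j = t) ∨ (∃ i, L i y = t)) ∧
  ∀ t, ((∃ j, L x j = t) ∧ (∃ i, L i y = t)) ↔ (t = L x y ∨ t = f)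

theorem IsLatin.transpose {n k : ℕ} {L : Fin n → Fin n → Fin k} (h : IsLatin n k L) :
    IsLatin n k (fun i j => L j i) := ⟨h.2, h.1⟩

theorem Rig.transpose {n k : ℕ} {E : Fin n → Fin n → Prop} {L : Fin n → Fin n → Fin k}
    (h : Rig E L) : Rig (fun i j => E j i) (fun i j => L j i) := by
  refine ⟨h.1.transpose, fun L' hL' hE => ?_⟩
  have := h.2 (fun i j => L' j i) hL'.transpose (fun i j hij => hE j i hij)
  funext i j
  exact congrFun (congrFun this j) i

theorem Crit.transpose {n k : ℕ} {L : Fin n → Fin n → Fin k} {x y : Fin n} {f : Fin k}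
    (h : Crit L x y f) : Crit (fun i j => L j i) y x f :=
  ⟨h.1, fun t => (h.2.1 t).symm, fun t => by rw [← h.2.2 t]; exact and_comm⟩

theorem Rig.single {n k : ℕ} {E : Fin n → Fin n → Prop} {L : Fin n → Fin n → Fin k}
    (h : Rig E L) {x y : Fin n} (hE : E x y) (t : Fin k) :
    (∃ j, L x j = t) ∨ (∃ i, L i y = t) := by
  by_contra! hc
  obtain ⟨h1, h2⟩ := hc
  obtain ⟨⟨hr, hcol⟩, hu⟩ := h
  have := hu (fun i j => if i = x ∧ j = y then t else L i j) ?_ ?_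
  · have h3 := congrFun (congrFun this x) y
    simp at h3
    exact h1 y h3.symm
  · refine ⟨fun i j j' hj => ?_, fun j i i' hi => ?_⟩
    · have := @hr i j j'
      grind
    · have := @hcol j i i'
      grind
  · intro i j hij
    grind

theorem Rig.crit {n k : ℕ} {E : Fin n → Fin n → Prop} {L : Fin n → Fin n → Fin k}
    (h : Rig E L) (hk : k + 2 = 2 * n) {x y : Fin n} (hE : E x y) : ∃ f, Crit L x y f := by
  classical
  have hs := fun t => h.single hE t
  let A := Finset.univ.image (fun j => L x j)
  let B := Finset.univ.image (fun i => L i y)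
  have hA : A.card = n := by
    simpa using Finset.card_image_of_injective Finset.univ (h.1.1 x)
  have hB : B.card = n := by
    simpa using Finset.card_image_of_injective Finset.univ (h.1.2 y)
  have hAB : A ∪ B = Finset.univ := by
    ext t
    simpa [A, B] using hs t
  have hc := Finset.card_union_add_card_inter A B
  rw [hAB, Finset.card_univ, Fintype.card_fin, hA, hB] at hc
  have h2 : (A ∩ B).card = 2 := by omega
  have hm : L x y ∈ A ∩ B := by simp [A, B]
  obtain ⟨f, hf⟩ : ∃ f, (A ∩ B).erase (L x y) = {f} := by
    rw [← Finset.card_eq_one, Finset.card_erase_of_mem hm, h2]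
  have hf' : ∀ t, (t ≠ L x y ∧ t ∈ A ∩ B) ↔ t = f := by
    intro t
    rw [← Finset.mem_erase, hf, Finset.mem_singleton]
  have hmem : ∀ t, t ∈ A ∩ B ↔ ((∃ j, L x j = t) ∧ (∃ i, L i y = t)) := by
    intro t; simp [A, B]
  refine ⟨f, ((hf' f).2 rfl).1, hs, fun t => ?_⟩
  rw [← hmem]
  have := hf' t
  by_cases ht : t = L x y
  · subst ht; simp [hm]
  · tauto

theorem Rig.rowperm {n k : ℕ} {E : Fin n → Fin n → Prop} {L : Fin n → Fin n → Fin k}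
    (h : Rig E L) (x : Fin n) (σ : Equiv.Perm (Fin n)) (h1 : ∀ y, σ y ≠ y → E x y)
    (h2 : ∀ y, σ y ≠ y → ∀ i, i ≠ x → L i y ≠ L x (σ y)) (y : Fin n) : σ y = y := by
  obtain ⟨⟨hr, hcol⟩, hu⟩ := h
  have := hu (fun i j => if i = x then L x (σ j) else L i j) ?_ ?_
  · have h3 := congrFun (congrFun this x) y
    simp at h3
    exact hr x h3
  · refine ⟨fun i j j' hj => ?_, fun j i i' hi => ?_⟩
    · by_cases hi : i = x
      · simp [hi] at hj
        exact σ.injective (hr x hj)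
      · simp [hi] at hj
        exact hr i hj
    · have := @hcol j i i'
      have h5 := h2 j
      by_cases hj : σ j = j <;> grind
  · intro i j hij
    by_cases hi : i = x
    · subst hi
      have : σ j = j := by
        by_contra hne
        exact hij (h1 j hne)
      simp [this]
    · simp [hi]

theorem Crit.other {n k : ℕ} {L : Fin n → Fin n → Fin k} (hL : IsLatin n k L) {x y : Fin n}
    {f : Fin k} (hf : Crit L x y f) {y' : Fin n} (hy : y' ≠ y) (hne : f ≠ L x y') (i : Fin n) :
    L i y ≠ L x y' := by
  intro he
  have := (hf.2.2 (L x y')).1 ⟨⟨y', rfl⟩, ⟨i, he⟩⟩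
  rcases this with h | h
  · exact hy (hL.1 x h)
  · exact hne h.symm

theorem Rig.pair {n k : ℕ} {E : Fin n → Fin n → Prop} {L : Fin n → Fin n → Fin k}
    (h : Rig E L) {x y z : Fin n} {f g : Fin k} (hy : E x y) (hz : E x z) (hyz : y ≠ z)
    (hf : Crit L x y f) (hg : Crit L x z g) : f = L x z ∨ g = L x y := by
  by_contra! hc
  have := h.rowperm x (Equiv.swap y z) ?_ ?_ y
  · rw [Equiv.swap_apply_left] at this
    exact hyz this.symm
  · intro w hw
    by_cases h1 : w = y
    · exact h1 ▸ hy
    by_cases h2 : w = z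
    · exact h2 ▸ hz
    exact absurd (Equiv.swap_apply_of_ne_of_ne h1 h2) hw
  · intro w hw i _
    by_cases h1 : w = y
    · subst h1
      rw [Equiv.swap_apply_left]
      exact hf.other h.1 hyz.symm hc.1 i
    by_cases h2 : w = z
    · subst h2
      rw [Equiv.swap_apply_right]
      exact hg.other h.1 hyz hc.2 i
    exact absurd (Equiv.swap_apply_of_ne_of_ne h1 h2) hw

theorem Rig.pair_col {n k : ℕ} {E : Fin n → Fin n → Prop} {L : Fin n → Fin n → Fin k}
    (h : Rig E L) {x y z : Fin n} {f g : Fin k} (hy : E y x) (hz : E z x) (hyz : y ≠ z)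
    (hf : Crit L y x f) (hg : Crit L z x g) : f = L z x ∨ g = L y x :=
  h.transpose.pair hy hz hyz hf.transpose hg.transpose

theorem Rig.three_aux {n k : ℕ} {E : Fin n → Fin n → Prop} {L : Fin n → Fin n → Fin k}
    (h : Rig E L) {x a b c : Fin n} {f g e : Fin k} (ha : E x a) (hb : E x b) (hc : E x c)
    (hab : a ≠ b) (hac : a ≠ c) (hbc : b ≠ c)
    (hf : Crit L x a f) (hg : Crit L x b g) (he : Crit L x c e)
    (h1 : f ≠ L x c) (h2 : g ≠ L x a) (h3 : e ≠ L x b) : False := by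
  let σ : Equiv.Perm (Fin n) := Equiv.swap a b * Equiv.swap a c
  have sa : σ a = c := by
    simp only [σ, Equiv.Perm.mul_apply, Equiv.swap_apply_left]
    exact Equiv.swap_apply_of_ne_of_ne hac.symm hbc.symm
  have sb : σ b = a := by
    simp only [σ, Equiv.Perm.mul_apply]
    rw [Equiv.swap_apply_of_ne_of_ne hab.symm hbc, Equiv.swap_apply_right]
  have sc : σ c = b := by
    simp [σ, Equiv.Perm.mul_apply]
  have so : ∀ w, w ≠ a → w ≠ b → w ≠ c → σ w = w := by
    intro w wa wb wc
    simp only [σ, Equiv.Perm.mul_apply]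
    rw [Equiv.swap_apply_of_ne_of_ne wa wc, Equiv.swap_apply_of_ne_of_ne wa wb]
  have := h.rowperm x σ ?_ ?_ a
  · exact hac (by rw [← sa, this])
  · intro w hw
    by_cases wa : w = a
    · exact wa ▸ ha
    by_cases wb : w = b
    · exact wb ▸ hb
    by_cases wc : w = c
    · exact wc ▸ hc
    exact absurd (so w wa wb wc) hw
  · intro w hw i _
    by_cases wa : w = a
    · subst wa; rw [sa]
      exact hf.other h.1 hac.symm h1 i
    by_cases wb : w = b
    · subst wb; rw [sb]
      exact hg.other h.1 hab h2 i
    by_cases wc : w = c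
    · subst wc; rw [sc]
      exact he.other h.1 hbc h3 i
    exact absurd (so w wa wb wc) hw

theorem Rig.three {n k : ℕ} {E : Fin n → Fin n → Prop} {L : Fin n → Fin n → Fin k}
    (h : Rig E L) (hk : k + 2 = 2 * n) {x a b c : Fin n}
    (ha : E x a) (hb : E x b) (hc : E x c)
    (hab : a ≠ b) (hac : a ≠ c) (hbc : b ≠ c) : False := by
  obtain ⟨f, hf⟩ := h.crit hk ha
  obtain ⟨g, hg⟩ := h.crit hk hb
  obtain ⟨e, he⟩ := h.crit hk hc
  have p1 := h.pair ha hb hab hf hg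
  have p2 := h.pair ha hc hac hf he
  have p3 := h.pair hb hc hbc hg he
  have q1 : L x a ≠ L x b := fun q => hab (h.1.1 x q)
  have q2 : L x a ≠ L x c := fun q => hac (h.1.1 x q)
  have q3 : L x b ≠ L x c := fun q => hbc (h.1.1 x q)
  by_cases hh : f = L x b
  · refine h.three_aux ha hb hc hab hac hbc hf hg he ?_ ?_ ?_ <;> grind
  · refine h.three_aux ha hc hb hac hab hbc.symm hf he hg ?_ ?_ ?_ <;> grind

theorem four_logic {α : Type*} (p q r s p' q' r' s' : α) (hp : p' ≠ p) (hq : q' ≠ q)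
    (hr : r' ≠ r) (hs : s' ≠ s) (h1 : p ≠ q) (h2 : p ≠ r) (h3 : s ≠ q) (h4 : s ≠ r) :
    ∃ P Q R S, (P = p ∨ P = p') ∧ (Q = q ∨ Q = q') ∧ (R = r ∨ R = r') ∧ (S = s ∨ S = s') ∧
      P ≠ Q ∧ P ≠ R ∧ S ≠ Q ∧ S ≠ R ∧ ¬ (P = p ∧ Q = q ∧ R = r ∧ S = s) := by
  by_contra! hc
  have a1 := hc p' q r s
  have a2 := hc p q' r s
  have a3 := hc p q r' s
  have a4 := hc p q r s'
  have a5 := hc p' q' r s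
  have a6 := hc p' q r' s
  have a7 := hc p' q r s'
  have a8 := hc p q' r' s
  have a9 := hc p q' r s'
  have a10 := hc p q r' s'
  have a11 := hc p q' r' s'
  have a12 := hc p' q r' s'
  have a13 := hc p' q' r s'
  have a14 := hc p' q' r' s
  have a15 := hc p' q' r' s'
  clear hc
  grind (splits := 60) +splitImp

theorem alt_color {n k : ℕ} (L : Fin n → Fin n → Fin k)
    (hk : k + 2 = 2 * n) {x x' y y' : Fin n} (hx : x ≠ x') (hy : y ≠ y') :
    ∃ t, t ≠ L x y ∧ (∀ j, j ≠ y → j ≠ y' → L x j ≠ t) ∧ (∀ i, i ≠ x → i ≠ x' → L i y ≠ t) := by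
  classical
  let A := ((Finset.univ.erase y).erase y').image (fun j => L x j)
  let B := ((Finset.univ.erase x).erase x').image (fun i => L i y)
  have hA : A.card ≤ n - 1 - 1 := by
    refine Finset.card_image_le.trans ?_
    rw [Finset.card_erase_of_mem (by simp [hy.symm]), Finset.card_erase_of_mem (by simp)]
    simp
  have hB : B.card ≤ n - 1 - 1 := by
    refine Finset.card_image_le.trans ?_
    rw [Finset.card_erase_of_mem (by simp [hx.symm]), Finset.card_erase_of_mem (by simp)]
    simp
  have hn : 2 ≤ n := by
    have := x.2; have := x'.2
    have : x.1 ≠ x'.1 := fun h => hx (Fin.ext h)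
    omega
  have : (insert (L x y) (A ∪ B)).card < (Finset.univ : Finset (Fin k)).card := by
    have h1 := Finset.card_insert_le (L x y) (A ∪ B)
    have h2 := Finset.card_union_le A B
    simp only [Finset.card_univ, Fintype.card_fin]
    omega
  obtain ⟨t, -, ht⟩ := Finset.exists_mem_notMem_of_card_lt_card this
  simp only [Finset.mem_insert, Finset.mem_union, not_or] at ht
  refine ⟨t, ht.1, fun j h1 h2 h3 => ht.2.1 ?_, fun i h1 h2 h3 => ht.2.2 ?_⟩
  · exact Finset.mem_image.2 ⟨j, by simp [h1, h2], h3⟩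
  · exact Finset.mem_image.2 ⟨i, by simp [h1, h2], h3⟩

theorem Rig.four {n k : ℕ} {E : Fin n → Fin n → Prop} {L : Fin n → Fin n → Fin k}
    (h : Rig E L) (hk : k + 2 = 2 * n) {x x' y y' : Fin n} (hx : x ≠ x') (hy : y ≠ y')
    (hp : E x y) (hq : E x y') (hr : E x' y) (hs : E x' y') : False := by
  obtain ⟨p', p1, p2, p3⟩ := alt_color L hk hx hy
  obtain ⟨q', q1, q2, q3⟩ := alt_color L hk hx hy.symm
  obtain ⟨r', r1, r2, r3⟩ := alt_color L hk hx.symm hy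
  obtain ⟨s', s1, s2, s3⟩ := alt_color L hk hx.symm hy.symm
  obtain ⟨⟨hro, hco⟩, hu⟩ := h
  obtain ⟨A, B, C, D, hA, hB, hC, hD, h1, h2, h3, h4, h5⟩ := four_logic _ _ _ _ p' q' r' s' p1 q1 r1 s1
    (fun e => hy (hro x e)) (fun e => hx (hco y e)) (fun e => hx (hco y' e).symm)
    (fun e => hy (hro x' e).symm)
  have A1 : ∀ j, j ≠ y → j ≠ y' → L x j ≠ A := by
    intro j a b; have := @hro x j y; grind
  have A2 : ∀ i, i ≠ x → i ≠ x' → L i y ≠ A := by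
    intro j a b; have := @hco y j x; grind
  have B1 : ∀ j, j ≠ y → j ≠ y' → L x j ≠ B := by
    intro j a b; have := @hro x j y'; grind
  have B2 : ∀ i, i ≠ x → i ≠ x' → L i y' ≠ B := by
    intro j a b; have := @hco y' j x; grind
  have C1 : ∀ j, j ≠ y → j ≠ y' → L x' j ≠ C := by
    intro j a b; have := @hro x' j y; grind
  have C2 : ∀ i, i ≠ x → i ≠ x' → L i y ≠ C := by
    intro j a b; have := @hco y j x'; grind
  have D1 : ∀ j, j ≠ y → j ≠ y' → L x' j ≠ D := by
    intro j a b; have := @hro x' j y'; grind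
  have D2 : ∀ i, i ≠ x → i ≠ x' → L i y' ≠ D := by
    intro j a b; have := @hco y' j x'; grind
  clear p2 p3 q2 q3 r2 r3 s2 s3 hA hB hC hD
  let L' : Fin n → Fin n → Fin k := fun i j =>
    if i = x then (if j = y then A else if j = y' then B else L i j)
    else if i = x' then (if j = y then C else if j = y' then D else L i j) else L i j
  have e : L' = L := by
    refine hu L' ⟨fun i j j' hj => ?_, fun j i i' hi => ?_⟩ ?_
    · have := @hro i j j'
      simp only [L'] at hj
      by_cases i1 : i = x
      · grind
      · by_cases i2 : i = x' <;> grind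
    · have := @hco j i i'
      simp only [L'] at hi
      by_cases j1 : j = y
      · grind
      · by_cases j2 : j = y' <;> grind
    · intro i j hij
      simp only [L']
      grind
  apply h5
  refine ⟨?_, ?_, ?_, ?_⟩
  · simpa [L'] using congrFun (congrFun e x) y
  · simpa [L', hy.symm] using congrFun (congrFun e x) y'
  · simpa [L', hx.symm] using congrFun (congrFun e x') y
  · simpa [L', hx.symm, hy.symm] using congrFun (congrFun e x') y'

theorem grid_logic {α : Type*} (S0 S1 S2 S3 S4 S5 : α → Prop)
    (c1 c2 c3 c4 c5 f1 f2 f3 f4 f5 z03 z14 z25 z05 : α)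
    (u1 : ∀ t, S0 t ∨ S1 t) (u2 : ∀ t, S1 t ∨ S2 t) (u3 : ∀ t, S2 t ∨ S3 t)
    (u4 : ∀ t, S3 t ∨ S4 t) (u5 : ∀ t, S4 t ∨ S5 t)
    (i1 : ∀ t, (S0 t ∧ S1 t) ↔ (t = c1 ∨ t = f1))
    (i2 : ∀ t, (S1 t ∧ S2 t) ↔ (t = c2 ∨ t = f2))
    (i3 : ∀ t, (S2 t ∧ S3 t) ↔ (t = c3 ∨ t = f3))
    (i4 : ∀ t, (S3 t ∧ S4 t) ↔ (t = c4 ∨ t = f4))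
    (i5 : ∀ t, (S4 t ∧ S5 t) ↔ (t = c5 ∨ t = f5))
    (n1 : f1 ≠ c1) (n2 : f2 ≠ c2) (n3 : f3 ≠ c3) (n4 : f4 ≠ c4) (n5 : f5 ≠ c5)
    (m1 : S0 z03) (m2 : S3 z03) (m3 : S1 z14) (m4 : S4 z14) (m5 : S2 z25) (m6 : S5 z25)
    (m7 : S0 z05) (m8 : S5 z05)
    (e1 : c1 ≠ z03) (e2 : c1 ≠ z05) (e3 : z03 ≠ z05)
    (e4 : c1 ≠ c2) (e5 : c1 ≠ z14) (e6 : c2 ≠ z14)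
    (e7 : c2 ≠ c3) (e8 : c2 ≠ z25) (e9 : c3 ≠ z25)
    (e10 : z03 ≠ c3) (e11 : z03 ≠ c4) (e12 : c3 ≠ c4)
    (e13 : z14 ≠ c4) (e14 : z14 ≠ c5) (e15 : c4 ≠ c5)
    (e16 : z05 ≠ z25) (e17 : z05 ≠ c5) (e18 : z25 ≠ c5)
    (d1 : f1 = c2 ∨ f2 = c1) (d2 : f2 = c3 ∨ f3 = c2)
    (d3 : f3 = c4 ∨ f4 = c3) (d4 : f4 = c5 ∨ f5 = c4) : False := by
  have a03 := i1 z03; have b03 := i2 z03; have g03 := i3 z03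
  have a14 := i2 z14; have b14 := i3 z14; have g14 := i4 z14
  have a25 := i3 z25; have b25 := i4 z25; have g25 := i5 z25
  have a05 := i1 z05; have b05 := i2 z05; have g05 := i3 z05
  have k05 := i4 z05; have l05 := i5 z05
  have w1 := u1 z03; have w2 := u2 z03; have w3 := u3 z03
  have w4 := u2 z14; have w5 := u3 z14; have w6 := u4 z14
  have w7 := u3 z25; have w8 := u4 z25; have w9 := u5 z25
  have w10 := u1 z05; have w11 := u2 z05; have w12 := u3 z05; have w13 := u4 z05
  have w14 := u5 z05
  clear i1 i2 i3 i4 i5 u1 u2 u3 u4 u5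
  rcases d1 with d1 | d1 <;> rcases d2 with d2 | d2 <;> rcases d3 with d3 | d3 <;>
    rcases d4 with d4 | d4 <;> grind (splits := 40)

theorem Rig.five {n k : ℕ} {E : Fin n → Fin n → Prop} {L : Fin n → Fin n → Fin k}
    (h : Rig E L) (hk : k + 2 = 2 * n) {x0 x1 x2 y0 y1 y2 : Fin n}
    (hx01 : x0 ≠ x1) (hx02 : x0 ≠ x2) (hx12 : x1 ≠ x2)
    (hy01 : y0 ≠ y1) (hy02 : y0 ≠ y2) (hy12 : y1 ≠ y2)
    (h1 : E x0 y0) (h2 : E x1 y0) (h3 : E x1 y1) (h4 : E x2 y1) (h5 : E x2 y2) : False := by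
  obtain ⟨f1, g1⟩ := h.crit hk h1
  obtain ⟨f2, g2⟩ := h.crit hk h2
  obtain ⟨f3, g3⟩ := h.crit hk h3
  obtain ⟨f4, g4⟩ := h.crit hk h4
  obtain ⟨f5, g5⟩ := h.crit hk h5
  have d1 := h.pair_col h1 h2 hx01 g1 g2
  have d2 := h.pair h2 h3 hy01 g2 g3
  have d3 := h.pair_col h3 h4 hx12 g3 g4
  have d4 := h.pair h4 h5 hy12 g4 g5
  have R : ∀ x {a b : Fin n}, a ≠ b → L x a ≠ L x b := fun x a b hab e => hab (h.1.1 x e)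
  have C : ∀ y {a b : Fin n}, a ≠ b → L a y ≠ L b y := fun y a b hab e => hab (h.1.2 y e)
  exact grid_logic (fun t => ∃ j, L x0 j = t) (fun t => ∃ i, L i y0 = t)
    (fun t => ∃ j, L x1 j = t) (fun t => ∃ i, L i y1 = t)
    (fun t => ∃ j, L x2 j = t) (fun t => ∃ i, L i y2 = t)
    (L x0 y0) (L x1 y0) (L x1 y1) (L x2 y1) (L x2 y2) f1 f2 f3 f4 f5
    (L x0 y1) (L x2 y0) (L x1 y2) (L x0 y2)
    g1.2.1 (fun t => (g2.2.1 t).symm) g3.2.1 (fun t => (g4.2.1 t).symm) g5.2.1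
    g1.2.2 (fun t => and_comm.trans (g2.2.2 t)) g3.2.2 (fun t => and_comm.trans (g4.2.2 t)) g5.2.2
    g1.1 g2.1 g3.1 g4.1 g5.1
    ⟨_, rfl⟩ ⟨_, rfl⟩ ⟨_, rfl⟩ ⟨_, rfl⟩ ⟨_, rfl⟩ ⟨_, rfl⟩ ⟨_, rfl⟩ ⟨_, rfl⟩
    (R x0 hy01) (R x0 hy02) (R x0 hy12)
    (C y0 hx01) (C y0 hx02) (C y0 hx12)
    (R x1 hy01) (R x1 hy02) (R x1 hy12)
    (C y1 hx01) (C y1 hx02) (C y1 hx12)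
    (R x2 hy01) (R x2 hy02) (R x2 hy12)
    (C y2 hx01) (C y2 hx02) (C y2 hx12)
    d1 d2 d3 d4

theorem count_bound {n : ℕ} (E : Fin n → Fin n → Prop) [∀ i j, Decidable (E i j)]
    (h3r : ∀ x a b c, E x a → E x b → E x c → a ≠ b → a ≠ c → b ≠ c → False)
    (h3c : ∀ x a b c, E a x → E b x → E c x → a ≠ b → a ≠ c → b ≠ c → False)
    (h4 : ∀ x x' y y', x ≠ x' → y ≠ y' → E x y → E x y' → E x' y → E x' y' → False)
    (h5 : ∀ x0 x1 x2 y0 y1 y2, x0 ≠ x1 → x0 ≠ x2 → x1 ≠ x2 → y0 ≠ y1 → y0 ≠ y2 → y1 ≠ y2 →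
      E x0 y0 → E x1 y0 → E x1 y1 → E x2 y1 → E x2 y2 → False) :
    5 * (Finset.univ.filter (fun p : Fin n × Fin n => E p.1 p.2)).card ≤ 8 * n := by
  classical
  set F := Finset.univ.filter (fun p : Fin n × Fin n => E p.1 p.2) with hF
  let r : Fin n → ℕ := fun x => (Finset.univ.filter (fun y => E x y)).card
  let c : Fin n → ℕ := fun y => (Finset.univ.filter (fun x => E x y)).card
  have hr2 : ∀ x, r x ≤ 2 := by
    intro x
    by_contra! hc
    obtain ⟨a, ha, b, hb, d, hd, h1, h2, h3⟩ := Finset.two_lt_card.1 hc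
    simp at ha hb hd
    exact h3r x a b d ha hb hd h1 h2 h3
  have hc2 : ∀ x, c x ≤ 2 := by
    intro x
    by_contra! hc
    obtain ⟨a, ha, b, hb, d, hd, h1, h2, h3⟩ := Finset.two_lt_card.1 hc
    simp at ha hb hd
    exact h3c x a b d ha hb hd h1 h2 h3
  have hr1 : ∀ x y, E x y → 1 ≤ r x := fun x y h => Finset.card_pos.2 ⟨y, by simp [h]⟩
  have hc1 : ∀ x y, E x y → 1 ≤ c y := fun x y h => Finset.card_pos.2 ⟨x, by simp [h]⟩
  have rother : ∀ x y, E x y → (∃ y', y' ≠ y ∧ E x y') ∨ r x = 1 := by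
    intro x y h
    by_contra! hc
    apply hc.2
    refine Finset.card_eq_one.2 ⟨y, ?_⟩
    ext w
    simp only [Finset.mem_filter, Finset.mem_univ, true_and, Finset.mem_singleton]
    refine ⟨fun hw => by_contra fun hne => hc.1 w hne hw, fun hw => hw ▸ h⟩
  have cother : ∀ x y, E x y → (∃ x', x' ≠ x ∧ E x' y) ∨ c y = 1 := by
    intro x y h
    by_contra! hc
    apply hc.2
    refine Finset.card_eq_one.2 ⟨x, ?_⟩
    ext w
    simp only [Finset.mem_filter, Finset.mem_univ, true_and, Finset.mem_singleton]
    refine ⟨fun hw => by_contra fun hne => hc.1 w hne hw, fun hw => hw ▸ h⟩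
  have runiq : ∀ x y y', E x y → E x y' → r x = 1 → y = y' := by
    intro x y y' h h' h1
    exact Finset.card_le_one.1 h1.le y (by simp [h]) y' (by simp [h'])
  have cuniq : ∀ x x' y, E x y → E x' y → c y = 1 → x = x' := by
    intro x y y' h h' h1
    exact Finset.card_le_one.1 h1.le x (by simp [h]) y (by simp [h'])
  have sumr : ∑ p ∈ F, (3 - r p.1) ≤ 2 * n := by
    rw [hF, Finset.sum_filter, Fintype.sum_prod_type]
    calc _ ≤ ∑ x : Fin n, 2 := by
          refine Finset.sum_le_sum fun x _ => ?_
          rw [← Finset.sum_filter]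
          dsimp only
          rw [Finset.sum_const, smul_eq_mul]
          change r x * (3 - r x) ≤ 2
          have := hr2 x
          interval_cases r x <;> simp
      _ = 2 * n := by simp [mul_comm]
  have sumc : ∑ p ∈ F, (3 - c p.2) ≤ 2 * n := by
    rw [hF, Finset.sum_filter, Fintype.sum_prod_type_right]
    calc _ ≤ ∑ x : Fin n, 2 := by
          refine Finset.sum_le_sum fun x _ => ?_
          rw [← Finset.sum_filter]
          dsimp only
          rw [Finset.sum_const, smul_eq_mul]
          change c x * (3 - c x) ≤ 2
          have := hc2 x
          interval_cases c x <;> simp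
      _ = 2 * n := by simp [mul_comm]
  let T := F.filter (fun p => r p.1 = 1 ∨ c p.2 = 1)
  let I := F.filter (fun p => ¬ (r p.1 = 1 ∨ c p.2 = 1))
  have hTI : T.card + I.card = F.card := Finset.card_filter_add_card_filter_not _
  have sum2 : 2 * F.card + T.card ≤ ∑ p ∈ F, ((3 - r p.1) + (3 - c p.2)) := by
    have : 2 * F.card + T.card = ∑ p ∈ F, (2 + if (r p.1 = 1 ∨ c p.2 = 1) then 1 else 0) := by
      have hT : T.card = _ := Finset.card_filter _ _
      rw [Finset.sum_add_distrib, Finset.sum_const, smul_eq_mul, hT, mul_comm]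
    rw [this]
    refine Finset.sum_le_sum fun p _ => ?_
    have := hr2 p.1
    have := hc2 p.2
    split_ifs <;> omega
  have hex : ∀ p ∈ I, ∃ q ∈ T, q ≠ p ∧ (q.1 = p.1 ∨ q.2 = p.2) := by
    rintro ⟨x, y⟩ hp
    simp only [I, hF, Finset.mem_filter, Finset.mem_univ, true_and, not_or] at hp
    obtain ⟨hE, hn1, hn2⟩ := hp
    obtain ⟨y', hy', hE1⟩ := (rother x y hE).resolve_right hn1
    obtain ⟨x', hx', hE2⟩ := (cother x y hE).resolve_right hn2
    rcases cother x y' hE1 with ⟨x'', hx'', hE3⟩ | h1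
    · rcases rother x' y hE2 with ⟨y'', hy'', hE4⟩ | h1
      · exfalso
        by_cases ex : x'' = x'
        · subst ex
          exact h4 x x'' y y' hx'.symm hy'.symm hE hE1 hE2 hE3
        by_cases ey : y'' = y'
        · subst ey
          exact h4 x x' y y'' hx'.symm hy'.symm hE hE1 hE2 hE4
        exact h5 x'' x x' y' y y'' hx'' ex hx'.symm hy' (Ne.symm ey) hy''.symm hE3 hE1 hE hE2 hE4
      · refine ⟨(x', y), by simp [T, hF, hE2, h1], by simp [hx'], by simp⟩
    · refine ⟨(x, y'), by simp [T, hF, hE1, h1], by simp [hy'], by simp⟩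
  choose! g hgT hgne hgadj using hex
  have hIT : I.card ≤ T.card := by
    refine Finset.card_le_card_of_injOn g (fun p hp => hgT p hp) ?_
    intro p hp p' hp' he
    have hpE : E p.1 p.2 := by
      have := (Finset.mem_filter.1 (Finset.mem_coe.1 hp)).1
      simpa [hF] using this
    have hpE' : E p'.1 p'.2 := by
      have := (Finset.mem_filter.1 (Finset.mem_coe.1 hp')).1
      simpa [hF] using this
    have a1 := hgT p hp
    have a2 := hgne p hp
    have a3 := hgadj p hp
    have b2 := hgne p' hp'
    have b3 := hgadj p' hp'
    rw [← he] at b2 b3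
    generalize g p = q at *
    obtain ⟨q1, q2⟩ := q
    obtain ⟨x, y⟩ := p
    obtain ⟨x', y'⟩ := p'
    simp only [T, hF, Finset.mem_filter, Finset.mem_univ, true_and] at a1
    obtain ⟨hq, h1 | h1⟩ := a1
    · have key : ∀ u v, E u v → (q1, q2) ≠ (u, v) → (q1 = u ∨ q2 = v) → q2 = v ∧ q1 ≠ u := by
        intro u v huv hne hor
        have : q1 ≠ u := by
          rintro rfl
          exact hne (by rw [runiq q1 q2 v hq huv h1])
        exact ⟨hor.resolve_left this, this⟩
      obtain ⟨e1, n1⟩ := key x y hpE a2 a3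
      obtain ⟨e2, n2⟩ := key x' y' hpE' b2 b3
      subst e1; subst e2
      by_cases hxx : x = x'
      · rw [hxx]
      · exact (h3c q2 q1 x x' hq hpE hpE' n1 n2 hxx).elim
    · have key : ∀ u v, E u v → (q1, q2) ≠ (u, v) → (q1 = u ∨ q2 = v) → q1 = u ∧ q2 ≠ v := by
        intro u v huv hne hor
        have : q2 ≠ v := by
          rintro rfl
          exact hne (by rw [cuniq q1 u q2 hq huv h1])
        exact ⟨hor.resolve_right this, this⟩
      obtain ⟨e1, n1⟩ := key x y hpE a2 a3
      obtain ⟨e2, n2⟩ := key x' y' hpE' b2 b3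
      subst e1; subst e2
      by_cases hxx : y = y'
      · rw [hxx]
      · exact (h3r q1 q2 y y' hq hpE hpE' n1 n2 hxx).elim
  rw [Finset.sum_add_distrib] at sum2
  omega

theorem lower_bound {n : ℕ} (hn : 1 ≤ n) (P : Fin n → Fin n → Option (Fin (2*n-2)))
    (h : UniquelyExtends n (2*n-2) P) : n^2 - (8*n)/5 ≤ numColored P := by
  classical
  obtain ⟨L, ⟨hL, hext⟩, hu⟩ := h
  have hR : Rig (fun i j => P i j = none) L := by
    refine ⟨hL, fun L' h1 h2 => hu L' ⟨h1, fun i j c hc => ?_⟩⟩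
    rw [h2 i j (by simp [hc])]
    exact hext i j c hc
  have hk : 2 * n - 2 + 2 = 2 * n := by omega
  have := count_bound (fun i j => P i j = none)
    (fun x a b c => hR.three hk) (fun x a b c => hR.transpose.three hk)
    (fun x x' y y' => hR.four hk)
    (fun x0 x1 x2 y0 y1 y2 => hR.five hk)
  have h2 := Finset.card_filter_add_card_filter_not
    (s := (Finset.univ : Finset (Fin n × Fin n))) (fun p : Fin n × Fin n => P p.1 p.2 = none)
  rw [Finset.card_univ, Fintype.card_prod, Fintype.card_fin] at h2
  unfold numColored
  rw [pow_two]
  simp only [ne_eq]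
  omega

def blockM : Fin 5 → Fin 5 → Fin 8 :=
  ![![7, 0, 1, 2, 3], ![0, 4, 2, 3, 1], ![4, 7, 3, 1, 2], ![5, 6, 7, 4, 0], ![6, 5, 4, 0, 7]]

def blockE : Fin 5 → Fin 5 → Bool :=
  ![![true, false, false, false, false], ![true, true, false, false, false],
    ![false, true, false, false, false], ![false, false, true, true, false],
    ![false, false, false, true, true]]

theorem blockM_row : ∀ i j j', blockM i j = blockM i j' → j = j' := by decide

theorem blockM_col : ∀ j i i', blockM i j = blockM i' j → i = i' := by decide

theorem block_unique (W : Fin 5 → Fin 5 → Fin 8) (hr : ∀ i j j', W i j = W i j' → j = j')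
    (hc : ∀ j i i', W i j = W i' j → i = i')
    (hW : ∀ i j, blockE i j = false → W i j = blockM i j) : W = blockM := by
  have r : ∀ i j j', j ≠ j' → W i j ≠ W i j' := fun i j j' h e => h (hr i j j' e)
  have c : ∀ j i i', i ≠ i' → W i j ≠ W i' j := fun i j j' h e => h (hc i j j' e)
  have R : ∀ i j, blockE i j = true → ∀ j', blockE i j' = false → W i j ≠ blockM i j' := by
    intro i j h j' h' e
    rw [← hW i j' h'] at e
    have := hr _ _ _ e
    rw [this, h'] at h
    simp at h
  have C : ∀ i j, blockE i j = true → ∀ i', blockE i' j = false → W i j ≠ blockM i' j := by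
    intro i j h j' h' e
    rw [← hW j' j h'] at e
    have := hc _ _ _ e
    rw [this, h'] at h
    simp at h
  have A : ∀ i j, blockE i j = true → ∀ w : Fin 8,
      (∀ w' : Fin 8, (∀ j', blockE i j' = false → w' ≠ blockM i j') →
        (∀ i', blockE i' j = false → w' ≠ blockM i' j) → w' = w) → W i j = w :=
    fun i j h w hw => hw _ (R i j h) (C i j h)
  have A2 : ∀ i j, blockE i j = true → ∀ w v : Fin 8,
      (∀ w' : Fin 8, (∀ j', blockE i j' = false → w' ≠ blockM i j') →
        (∀ i', blockE i' j = false → w' ≠ blockM i' j) → w' = w ∨ w' = v) → W i j = w ∨ W i j = v :=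
    fun i j h w v hw => hw _ (R i j h) (C i j h)
  have w00 : W 0 0 = 7 := A 0 0 (by decide) 7 (by decide)
  have w21 : W 2 1 = 7 := A 2 1 (by decide) 7 (by decide)
  have w32 : W 3 2 = 7 := A 3 2 (by decide) 7 (by decide)
  have w44 : W 4 4 = 7 := A 4 4 (by decide) 7 (by decide)
  have w10 : W 1 0 = 0 := (A2 1 0 (by decide) 0 7 (by decide)).resolve_right
    (w00 ▸ c 0 1 0 (by decide))
  have w11 : W 1 1 = 4 := (A2 1 1 (by decide) 4 7 (by decide)).resolve_right
    (w21 ▸ c 1 1 2 (by decide))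
  have w33 : W 3 3 = 4 := (A2 3 3 (by decide) 4 7 (by decide)).resolve_right
    (w32 ▸ r 3 3 2 (by decide))
  have w43 : W 4 3 = 0 := (A2 4 3 (by decide) 0 7 (by decide)).resolve_right
    (w44 ▸ r 4 3 4 (by decide))
  funext i j
  by_cases h : blockE i j = false
  · exact hW i j h
  · fin_cases i <;> fin_cases j <;> first | assumption | exact absurd rfl h

def phi (N a b : ℕ) : ℕ :=
  if a = N then (2 * b) % N else if b = N then (2 * a) % N else (a + b) % N

theorem phi_comm (N a b : ℕ) : phi N a b = phi N b a := by
  unfold phi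
  split_ifs
  · subst_vars; rfl
  · rfl
  · rfl
  · rw [Nat.add_comm]

theorem mod_add_inj {N a b c : ℕ} (hb : b < N) (hc : c < N) (h : (a + b) % N = (a + c) % N) :
    b = c := by
  have h1 : b ≡ c [MOD N] := Nat.ModEq.add_left_cancel' a h
  exact Nat.ModEq.eq_of_lt_of_lt h1 hb hc

theorem mod_two_inj {N b c : ℕ} (hN : N % 2 = 1) (hb : b < N) (hc : c < N)
    (h : (2 * b) % N = (2 * c) % N) : b = c := by
  have h1 : b ≡ c [MOD N] := by
    refine Nat.ModEq.cancel_left_of_coprime (c := 2) ?_ h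
    rw [← Nat.coprime_iff_gcd_eq_one, Nat.coprime_two_right, Nat.odd_iff]
    exact hN
  exact Nat.ModEq.eq_of_lt_of_lt h1 hb hc

theorem phi_inj {N a b c : ℕ} (hN : N % 2 = 1) (ha : a ≤ N) (hb : b ≤ N) (hc : c ≤ N)
    (hab : b ≠ a) (hac : c ≠ a) (h : phi N a b = phi N a c) : b = c := by
  unfold phi at h
  by_cases h1 : a = N
  · simp only [h1, if_true] at h
    exact mod_two_inj hN (by omega) (by omega) h
  · simp only [h1, if_false] at h
    split_ifs at h with h2 h3 h3
    · omega
    · rw [two_mul] at h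
      exact absurd (mod_add_inj (by omega) (by omega) h).symm hac
    · rw [two_mul] at h
      exact absurd (mod_add_inj (by omega) (by omega) h) hab
    · exact mod_add_inj (by omega) (by omega) h

theorem phi_lt {N a b : ℕ} (hN : N % 2 = 1) : phi N a b < N := by
  unfold phi
  have : 0 < N := by omega
  split_ifs <;> exact Nat.mod_lt _ this

/-- The one-factorization of the complete graph on `N + 1` vertices. -/
def phiF {N : ℕ} (hN : N % 2 = 1) (a b : Fin (N + 1)) : Fin N := ⟨phi N a b, phi_lt hN⟩

theorem phiF_comm {N : ℕ} (hN : N % 2 = 1) (a b : Fin (N + 1)) : phiF hN a b = phiF hN b a :=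
  Fin.ext (phi_comm N a b)

theorem phiF_inj {N : ℕ} (hN : N % 2 = 1) {a b c : Fin (N + 1)} (hab : b ≠ a) (hac : c ≠ a)
    (h : phiF hN a b = phiF hN a c) : b = c :=
  Fin.ext (phi_inj hN (by omega) (by omega) (by omega) (fun e => hab (Fin.ext e))
    (fun e => hac (Fin.ext e)) (Fin.ext_iff.1 h))

theorem phiF_surj {N : ℕ} (hN : N % 2 = 1) (a : Fin (N + 1)) (s : Fin N) :
    ∃ b, b ≠ a ∧ phiF hN a b = s := by
  have : Function.Bijective (fun b : {b : Fin (N + 1) // b ≠ a} => phiF hN a b) := by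
    rw [Fintype.bijective_iff_injective_and_card]
    refine ⟨fun b c h => Subtype.ext (phiF_inj hN b.2 c.2 h), ?_⟩
    simp
  obtain ⟨b, hb⟩ := this.2 s
  exact ⟨b, b.2, hb⟩

abbrev Cell (N : ℕ) := Fin (N + 1) × Fin 5
abbrev Col (N : ℕ) := Fin 8 ⊕ ((Fin N × Bool) × Fin 5)

def bigL {N : ℕ} (hN : N % 2 = 1) (x y : Cell N) : Col N :=
  if x.1 = y.1 then Sum.inl (blockM x.2 y.2)
  else Sum.inr ((phiF hN x.1 y.1, decide (x.1 < y.1)), x.2 + y.2)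

def bigE {N : ℕ} (x y : Cell N) : Prop := x.1 = y.1 ∧ blockE x.2 y.2 = true

theorem bigL_row {N : ℕ} (hN : N % 2 = 1) (x y y' : Cell N) (h : bigL hN x y = bigL hN x y') :
    y = y' := by
  obtain ⟨a, i⟩ := x
  obtain ⟨b, j⟩ := y
  obtain ⟨b', j'⟩ := y'
  unfold bigL at h
  dsimp only at h
  by_cases h1 : a = b <;> by_cases h2 : a = b'
  · rw [if_pos h1, if_pos h2] at h
    rw [← h1, ← h2, blockM_row _ _ _ (Sum.inl.inj h)]
  · rw [if_pos h1, if_neg h2] at h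
    exact absurd h (by simp)
  · rw [if_neg h1, if_pos h2] at h
    exact absurd h (by simp)
  · rw [if_neg h1, if_neg h2] at h
    simp only [Sum.inr.injEq, Prod.mk.injEq, add_right_inj] at h
    obtain ⟨⟨h3, -⟩, h4⟩ := h
    rw [phiF_inj hN (Ne.symm h1) (Ne.symm h2) h3, h4]

theorem bigL_col {N : ℕ} (hN : N % 2 = 1) (y x x' : Cell N) (h : bigL hN x y = bigL hN x' y) :
    x = x' := by
  obtain ⟨a, i⟩ := y
  obtain ⟨b, j⟩ := x
  obtain ⟨b', j'⟩ := x'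
  unfold bigL at h
  by_cases h1 : b = a <;> by_cases h2 : b' = a <;> simp [h1, h2] at h
  · rw [h1, h2, blockM_col _ _ _ h]
  · obtain ⟨⟨h3, -⟩, h4⟩ := h
    rw [phiF_comm hN b, phiF_comm hN b'] at h3
    rw [phiF_inj hN h1 h2 h3, h4]

theorem big_unique {N : ℕ} (hN : N % 2 = 1) (M : Cell N → Cell N → Col N)
    (hr : ∀ x y y', M x y = M x y' → y = y') (hc : ∀ y x x', M x y = M x' y → x = x')
    (hM : ∀ x y, ¬ bigE x y → M x y = bigL hN x y) : M = bigL hN := by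
  have hdiag : ∀ a i j, ∃ w : Fin 8, M (a, i) (a, j) = Sum.inl w := by
    intro a i j
    rcases hv : M (a, i) (a, j) with w | ⟨⟨s, o⟩, t⟩
    · exact ⟨w, rfl⟩
    exfalso
    obtain ⟨b, hb, hs⟩ := phiF_surj hN a s
    by_cases ho : decide (a < b) = o
    · have h1 : M (a, i) (b, t - i) = Sum.inr ((s, o), t) := by
        rw [hM _ _ (fun h => hb h.1.symm)]
        simp [bigL, hb.symm, hs, ho]
      have := hr _ _ _ (hv.trans h1.symm)
      exact hb (Prod.ext_iff.1 this).1.symm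
    · have ho' : decide (b < a) = o := by
        rcases lt_trichotomy a b with h | h | h
        · have h' : ¬ b < a := not_lt.2 h.le
          rw [decide_eq_true h] at ho
          rw [decide_eq_false h']
          exact (Bool.eq_false_of_not_eq_true (fun e => ho e.symm)).symm
        · exact absurd h.symm hb
        · have h' : ¬ a < b := not_lt.2 h.le
          rw [decide_eq_false h'] at ho
          rw [decide_eq_true h]
          exact (Bool.eq_true_of_not_eq_false (fun e => ho e.symm)).symm
      have h1 : M (b, t - j) (a, j) = Sum.inr ((s, o), t) := by
        rw [hM _ _ (fun h => hb h.1)]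
        simp [bigL, hb, phiF_comm hN b a, hs, ho']
      have := hc _ _ _ (hv.trans h1.symm)
      exact hb (Prod.ext_iff.1 this).1.symm
  choose W hW using hdiag
  have hWu : ∀ a, W a = blockM := by
    intro a
    refine block_unique (W a) (fun i j j' h => ?_) (fun j i i' h => ?_) (fun i j h => ?_)
    · have := hr (a, i) (a, j) (a, j') (by rw [hW, hW, h])
      exact (Prod.ext_iff.1 this).2
    · have := hc (a, j) (a, i) (a, i') (by rw [hW, hW, h])
      exact (Prod.ext_iff.1 this).2
    · have := hM (a, i) (a, j) (fun h' => by simp [bigE, h] at h')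
      rw [hW] at this
      simpa [bigL] using this
  funext x y
  by_cases hxy : x.1 = y.1
  · obtain ⟨a, i⟩ := x
    obtain ⟨b, j⟩ := y
    simp only at hxy
    subst hxy
    rw [hW, hWu]
    simp [bigL]
  · exact hM x y (fun h => hxy h.1)

theorem upper_bound (m n : ℕ) (hm : 1 ≤ m) (hn : n = 10 * m) :
    ∃ P : Fin n → Fin n → Option (Fin (2*n-2)),
      UniquelyExtends n (2*n-2) P ∧ numColored P ≤ n^2 - (8*n)/5 := by
  classical
  obtain ⟨N, hN1⟩ : ∃ N, N = 2 * m - 1 := ⟨_, rfl⟩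
  have hN : N % 2 = 1 := by omega
  have hX : Fintype.card (Fin n) = Fintype.card (Cell N) := by
    simp [Cell]; omega
  have hK : Fintype.card (Col N) = Fintype.card (Fin (2 * n - 2)) := by
    simp [Col]; omega
  let ρ : Fin n ≃ Cell N := Fintype.equivOfCardEq hX
  let ε : Col N ≃ Fin (2 * n - 2) := Fintype.equivOfCardEq hK
  let P : Fin n → Fin n → Option (Fin (2*n-2)) := fun i j =>
    if bigE (ρ i) (ρ j) then none else some (ε (bigL hN (ρ i) (ρ j)))
  refine ⟨P, ⟨fun i j => ε (bigL hN (ρ i) (ρ j)), ⟨⟨?_, ?_⟩, ?_⟩, ?_⟩, ?_⟩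
  · intro i j j' h
    exact ρ.injective (bigL_row hN _ _ _ (ε.injective h))
  · intro j i i' h
    exact ρ.injective (bigL_col hN _ _ _ (ε.injective h))
  · intro i j c h
    simp only [P] at h
    split_ifs at h
    exact Option.some.inj h
  · rintro L' ⟨hL', hext⟩
    have := big_unique hN (fun x y => ε.symm (L' (ρ.symm x) (ρ.symm y))) ?_ ?_ ?_
    · funext i j
      have h1 := congrFun (congrFun this (ρ i)) (ρ j)
      simp only [Equiv.symm_apply_apply] at h1
      rw [← h1, Equiv.apply_symm_apply]
    · intro x y y' h
      exact ρ.symm.injective (hL'.1 _ (ε.symm.injective h))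
    · intro x y y' h
      exact ρ.symm.injective (hL'.2 _ (ε.symm.injective h))
    · intro x y h
      rw [Equiv.symm_apply_eq]
      apply hext
      simp [P, h]
  · have h2 := Finset.card_filter_add_card_filter_not
      (s := (Finset.univ : Finset (Fin n × Fin n))) (fun p : Fin n × Fin n => P p.1 p.2 = none)
    rw [Finset.card_univ, Fintype.card_prod, Fintype.card_fin] at h2
    have h3 : ((Finset.univ : Finset (Fin (N + 1))) ×ˢ
        (Finset.univ.filter (fun q : Fin 5 × Fin 5 => blockE q.1 q.2 = true))).card ≤
        (Finset.univ.filter (fun p : Fin n × Fin n => P p.1 p.2 = none)).card := by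
      refine Finset.card_le_card_of_injOn
        (fun z => (ρ.symm (z.1, z.2.1), ρ.symm (z.1, z.2.2))) ?_ ?_
      · rintro ⟨a, i, j⟩ hz
        simp at hz
        rw [Finset.mem_coe, Finset.mem_filter]
        refine ⟨Finset.mem_univ _, if_pos ?_⟩
        simp [bigE, hz]
      · rintro ⟨a, i, j⟩ - ⟨a', i', j'⟩ - he
        simp at he
        simp [he]
    have h4 : (Finset.univ.filter (fun q : Fin 5 × Fin 5 => blockE q.1 q.2 = true)).card = 8 := by
      decide
    rw [Finset.card_product, h4, Finset.card_univ, Fintype.card_fin] at h3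
    unfold numColored
    rw [pow_two]
    simp only [ne_eq]
    omega

theorem defining_number_2n_minus_2 (n : ℕ) (hn : 10 ∣ n) :
    definingNumber n (2*n-2) = n^2 - (8*n)/5 := by
  obtain ⟨m, hm⟩ := hn
  rcases Nat.eq_zero_or_pos m with h0 | hpos
  · have hn0 : n = 0 := by omega
    subst hn0
    unfold definingNumber
    have : (0 : ℕ) ∈ {m | ∃ P : Fin 0 → Fin 0 → Option (Fin (2*0-2)),
        UniquelyExtends 0 (2*0-2) P ∧ numColored P = m} := by
      refine ⟨fun i => i.elim0, ⟨fun i => i.elim0, ⟨⟨fun i => i.elim0, fun i => i.elim0⟩,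
        fun i => i.elim0⟩, fun L _ => funext fun i => i.elim0⟩, ?_⟩
      simp [numColored]
    exact Nat.le_zero.1 (Nat.sInf_le this)
  · obtain ⟨P, hP, hle⟩ := upper_bound m n hpos hm
    unfold definingNumber
    apply le_antisymm
    · exact le_trans (Nat.sInf_le (m := numColored P) ⟨P, hP, rfl⟩) hle
    · refine le_csInf ⟨_, P, hP, rfl⟩ ?_
      rintro b ⟨Q, hQ, rfl⟩
      exact lower_bound (by omega) Q hQ
end
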